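/- Let d ≥ 2, α ∈ (0,1), and let μ be an α-stable distribution on ℝ^d with no shift, characteristic exponent Φ_μ(z) = |z|^α V(u_z), and spectral spherical measure λ(dv) = P(v) ω(dv), where P is the restriction to S^{d−1} of a polynomial of degree at most q, P ≥ 0 and P not identically zero. Then exp(−Φ_μ) ∈ L¹(ℝ^d), and the density g of μ satisfies, for every x ≠ 0, g(x) = Σ_{k=1}^∞ ((−2^α)^k π^{−d/2} / (k! |x|^{kα+d})) Σ_{j=0}^{kq} (Γ((j+kα+d)/2) / Γ((j−kα)/2)) S_{j,k}(u_x), where S_{j,k} = (−i)^j proj_j(V^k). The double series converges absolutely, uniformly on {x : |x| ≥ r} for every r > 0. -/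

import Mathlib

open MeasureTheory Real Filter Topology
open scoped RealInnerProductSpace ENNReal NNReal

noncomputable section

namespace StablePaper

abbrev Ed (d : ℕ) : Type := EuclideanSpace ℝ (Fin d)

abbrev Sph (d : ℕ) := Metric.sphere (0 : Ed d) 1

/-- The surface measure `ω` on the unit sphere `S^{d-1}`. -/
def ωd (d : ℕ) : Measure (Sph d) := (volume : Measure (Ed d)).toSphere

/-- `u_z = z/|z|` for `z ≠ 0`, as a point of the unit sphere. -/
def unitize {d : ℕ} (z : Ed d) (hz : z ≠ 0) : Sph d :=
  ⟨‖z‖⁻¹ • z, by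
    rw [mem_sphere_iff_norm, sub_zero, norm_smul, norm_inv, norm_norm,
      inv_mul_cancel₀ (norm_ne_zero_iff.mpr hz)]⟩

/-- Negation on the unit sphere. -/
def negS {d : ℕ} (u : Sph d) : Sph d :=
  ⟨-(u : Ed d), by
    rw [mem_sphere_iff_norm, sub_zero, norm_neg]
    have := u.2
    rwa [mem_sphere_iff_norm, sub_zero] at this⟩

/-- Rising factorial (Pochhammer symbol) `(b)_n`. -/
def risingFactorial (b : ℝ) (n : ℕ) : ℝ := ∏ i ∈ Finset.range n, (b + i)

/-- The Gegenbauer polynomial `C_j^b(t)` (for `b > 0`), via its explicit sum formula. -/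
def gegenbauer (b : ℝ) (j : ℕ) (t : ℝ) : ℝ :=
  ∑ m ∈ Finset.range (j / 2 + 1),
    (-1 : ℝ) ^ m * 2 ^ (j - 2 * m) * risingFactorial b (j - m) /
      ((Nat.factorial m : ℝ) * (Nat.factorial (j - 2 * m) : ℝ)) * t ^ (j - 2 * m)

/-- The normalized (ultraspherical) polynomial `C̃_j^b(t) = C_j^b(t)/C_j^b(1)`;
for `b = 0` it is the Chebyshev polynomial `T_j`. -/
def gegenbauerN (b : ℝ) (j : ℕ) (t : ℝ) : ℝ :=
  if b = 0 then (Polynomial.Chebyshev.T ℝ (j : ℤ)).eval t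
  else gegenbauer b j t / gegenbauer b j 1

/-- `c_{j,d} = dim ℋ_{j,d}`. -/
def cdim (d j : ℕ) : ℕ :=
  if j = 0 then 1 else Nat.choose (j + d - 2) j + Nat.choose (j + d - 3) (j - 1)

/-- The surface area `A(S^{d-1}) = 2 π^{d/2} / Γ(d/2)`. -/
def sphereArea (d : ℕ) : ℝ := 2 * Real.pi ^ ((d : ℝ) / 2) / Real.Gamma ((d : ℝ) / 2)

/-- Projection onto spherical harmonics of degree `j` (real-valued version):
`(proj_j f)(u) = (c_{j,d}/A(S^{d-1})) ∫ C̃_j^{(d-2)/2}(⟨u,v⟩) f(v) ω(dv)`. -/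
def projR (d j : ℕ) (f : Sph d → ℝ) (u : Sph d) : ℝ :=
  (cdim d j : ℝ) / sphereArea d *
    ∫ v, gegenbauerN (((d : ℝ) - 2) / 2) j ⟪(u : Ed d), (v : Ed d)⟫ * f v ∂(ωd d)

/-- Projection onto spherical harmonics of degree `j` (complex-valued version). -/
def projC (d j : ℕ) (f : Sph d → ℂ) (u : Sph d) : ℂ :=
  ((cdim d j : ℂ) / (sphereArea d : ℂ)) *
    ∫ v, (gegenbauerN (((d : ℝ) - 2) / 2) j ⟪(u : Ed d), (v : Ed d)⟫ : ℂ) * f v ∂(ωd d)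

/-- The coefficients `w_j(α)`. -/
def w (d : ℕ) (α : ℝ) (j : ℕ) : ℝ :=
  Real.pi ^ ((d : ℝ) / 2) * Real.Gamma (α + 1) /
    (2 ^ (α - 1) * Real.Gamma (((j : ℝ) + α + d) / 2) * Real.Gamma ((α - j) / 2 + 1))

/-- The characteristic exponent of an `α`-stable distribution (`α ≠ 1`) with
spectral spherical measure `Λ`. -/
def charExp (d : ℕ) (α : ℝ) (Λ : Measure (Sph d)) (z : Ed d) : ℂ :=
  ∫ v, (|⟪z, (v : Ed d)⟫| ^ α : ℝ) *
      (1 - Complex.I * (Real.tan (Real.pi * α / 2) : ℂ) *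
        (Real.sign ⟪z, (v : Ed d)⟫ : ℂ)) ∂Λ

/-- `V(u)`, so that `Φ_μ(z) = |z|^α V(u_z)`. -/
def Vfun (d : ℕ) (α : ℝ) (Λ : Measure (Sph d)) (u : Sph d) : ℂ :=
  charExp d α Λ (u : Ed d)

/-- The characteristic exponent of a `1`-stable distribution with
spectral spherical measure `Λ`. -/
def charExp1 (d : ℕ) (Λ : Measure (Sph d)) (z : Ed d) : ℂ :=
  ∫ v, ((|⟪z, (v : Ed d)⟫| : ℝ) : ℂ) +
      Complex.I * ((2 / Real.pi * (⟪z, (v : Ed d)⟫ *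
        Real.log |⟪z, (v : Ed d)⟫|) : ℝ) : ℂ) ∂Λ

/-- The spectral spherical measure `λ(dv) = P(v) ω(dv)`. -/
def specMeasure (d : ℕ) (P : Sph d → ℝ) : Measure (Sph d) :=
  (ωd d).withDensity (fun v => ENNReal.ofReal (P v))

/-- `μ` has Fourier transform `exp (-Φ)` where `Φ` is the `α`-stable characteristic
exponent with spectral spherical measure `Λ` (case `α ≠ 1`). -/
def IsStableChar (d : ℕ) (α : ℝ) (Λ : Measure (Sph d)) (μ : Measure (Ed d)) : Prop :=
  ∀ z : Ed d, ∫ x, Complex.exp (Complex.I * (⟪z, x⟫ : ℂ)) ∂μ =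
    Complex.exp (- charExp d α Λ z)

/-- `μ` has Fourier transform `exp (-Φ)` where `Φ` is the `1`-stable characteristic
exponent with spectral spherical measure `Λ`. -/
def IsStableChar1 (d : ℕ) (Λ : Measure (Sph d)) (μ : Measure (Ed d)) : Prop :=
  ∀ z : Ed d, ∫ x, Complex.exp (Complex.I * (⟪z, x⟫ : ℂ)) ∂μ =
    Complex.exp (- charExp1 d Λ z)

/-- `μ` is nondegenerate: its support is not contained in any proper affine subspace. -/
def Nondegenerate (d : ℕ) (μ : Measure (Ed d)) : Prop :=
  ∀ (a : Ed d) (W : Submodule ℝ (Ed d)), W ≠ ⊤ →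
    μ ((fun x => a + x) '' (W : Set (Ed d))) < 1

/-- `P` is the restriction to the sphere of a polynomial on `ℝ^d`. -/
def IsPolyRestriction (d : ℕ) (P : Sph d → ℝ) : Prop :=
  ∃ p : MvPolynomial (Fin d) ℝ,
    ∀ u : Sph d, P u = MvPolynomial.eval (fun i => (u : Ed d) i) p

/-- `P` is the restriction to the sphere of a polynomial of degree at most `q`. -/
def IsPolyRestrictionDeg (d q : ℕ) (P : Sph d → ℝ) : Prop :=
  ∃ p : MvPolynomial (Fin d) ℝ, p.totalDegree ≤ q ∧
    ∀ u : Sph d, P u = MvPolynomial.eval (fun i => (u : Ed d) i) p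

/-- `f` is a spherical harmonic of degree `j`: the restriction to the sphere of a
homogeneous harmonic polynomial of degree `j`. -/
def IsSphericalHarmonicC (d j : ℕ) (f : Sph d → ℂ) : Prop :=
  ∃ p : MvPolynomial (Fin d) ℂ, p.IsHomogeneous j ∧
    (∑ i : Fin d, MvPolynomial.pderiv i (MvPolynomial.pderiv i p)) = 0 ∧
    ∀ u : Sph d, f u = MvPolynomial.eval (fun i => ((u : Ed d) i : ℂ)) p

/-- `S_{j,k} = (-i)^j proj_j (V^k)`. -/
def SHk (d : ℕ) (α : ℝ) (Λ : Measure (Sph d)) (j k : ℕ) (u : Sph d) : ℂ :=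
  (-Complex.I) ^ j * projC d j (fun v => (Vfun d α Λ v) ^ k) u

/-- `S_{j,p} = (-i)^j proj_j (V^p)` for real exponents `p` (principal branch). -/
def SHp (d : ℕ) (α : ℝ) (Λ : Measure (Sph d)) (j : ℕ) (p : ℝ) (u : Sph d) : ℂ :=
  (-Complex.I) ^ j * projC d j (fun v => (Vfun d α Λ v) ^ (p : ℂ)) u

/-- `g` is the density of the stable distribution with characteristic exponent
`charExp d α Λ`, given by the Fourier inversion formula. -/
def IsDensityOf (d : ℕ) (α : ℝ) (Λ : Measure (Sph d)) (g : Ed d → ℝ) : Prop :=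
  ∀ x : Ed d, (g x : ℂ) =
    (((2 * Real.pi) ^ d)⁻¹ : ℝ) *
      ∫ z : Ed d, Complex.exp (-(Complex.I * (⟪x, z⟫ : ℂ))) *
        Complex.exp (- charExp d α Λ z)

/-- Harmonic numbers `s_n`. -/
def harmonicNum (n : ℕ) : ℝ := ∑ i ∈ Finset.range n, (1 : ℝ) / (i + 1)

def betaD (d : ℕ) : ℝ :=
  if Even d then 1 - Real.log 2 - harmonicNum (d / 2) / 2
  else 1 - harmonicNum (d + 1) + harmonicNum ((d + 1) / 2) / 2

/-- The coefficients `w*_j` (for odd `j`). -/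
def wstar (d j : ℕ) : ℝ :=
  if j = 1 then Real.pi ^ ((d : ℝ) / 2) * betaD d / Real.Gamma ((d : ℝ) / 2 + 1)
  else (-1 : ℝ) ^ ((j - 3) / 2) * Real.pi ^ ((d : ℝ) / 2) *
      Real.Gamma (((j : ℝ) - 1) / 2) / (2 * Real.Gamma (((d : ℝ) + 1 + j) / 2))

/-- The Bessel function of the first kind `J_τ`. -/
def besselJ (τ : ℝ) (x : ℝ) : ℝ :=
  ∑' k : ℕ, (-1 : ℝ) ^ k * (x / 2) ^ (2 * (k : ℝ) + τ) /
    ((Nat.factorial k : ℝ) * Real.Gamma ((k : ℝ) + τ + 1))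

/-- The `(j,k)`-term `((-2^α)^k π^{-d/2} / (k! ρ^{kα+d})) (Γ((j+kα+d)/2)/Γ((j-kα)/2)) S_{j,k}(u)`
of the spherical-harmonic series for the density (`α ∈ (0,1)`), at radius `ρ`. -/
def phiTerm (d : ℕ) (α : ℝ) (Λ : Measure (Sph d)) (j k : ℕ) (ρ : ℝ) (u : Sph d) : ℂ :=
  ((((-((2 : ℝ) ^ α)) ^ k * Real.pi ^ (-(d : ℝ) / 2) /
      ((Nat.factorial k : ℝ) * ρ ^ ((k : ℝ) * α + d)) *
      (Real.Gamma (((j : ℝ) + k * α + d) / 2) /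
        Real.Gamma (((j : ℝ) - k * α) / 2))) : ℝ) : ℂ) * SHk d α Λ j k u

/-- The `k`-th term `((-2^α)^k π^{-d/2} / (k! r^{kα+1})) (Γ((kα+d)/2)/Γ(-kα/2)) ∫ V^k dω`
of the series for the density of `|X|`. -/
def radTerm (d : ℕ) (α : ℝ) (Λ : Measure (Sph d)) (k : ℕ) (r : ℝ) : ℂ :=
  ((((-((2 : ℝ) ^ α)) ^ k * Real.pi ^ (-(d : ℝ) / 2) /
      ((Nat.factorial k : ℝ) * r ^ ((k : ℝ) * α + 1)) *
      (Real.Gamma (((k : ℝ) * α + d) / 2) / Real.Gamma (-((k : ℝ) * α) / 2))) : ℝ) : ℂ) *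
    ∫ u, (Vfun d α Λ u) ^ k ∂(ωd d)

end StablePaper

namespace StablePaper

lemma integrableOn_beta {a b : ℝ} (ha : 0 < a) (hb : 0 < b) :
    IntegrableOn (fun t : ℝ => t ^ (a - 1) * (1 - t) ^ (b - 1)) (Set.Ioc 0 1) := by
  have h := Complex.betaIntegral_convergent (u := a) (v := b) (by simpa) (by simpa)
  rw [intervalIntegrable_iff_integrableOn_Ioc_of_le (by simp)] at h
  refine IntegrableOn.congr_fun h.re (fun t ht => ?_) measurableSet_Ioc
  have e : ((t : ℂ) ^ ((a : ℂ) - 1) * (1 - (t : ℂ)) ^ ((b : ℂ) - 1))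
      = ((t ^ (a - 1) * (1 - t) ^ (b - 1) : ℝ) : ℂ) := by
    push_cast
    rw [Complex.ofReal_cpow ht.1.le, Complex.ofReal_cpow (by linarith [ht.2])]
    push_cast
    rfl
  simp only [e]
  simp

lemma integral_beta {a b : ℝ} (ha : 0 < a) (hb : 0 < b) :
    ∫ t in Set.Ioc (0 : ℝ) 1, t ^ (a - 1) * (1 - t) ^ (b - 1)
      = Real.Gamma a * Real.Gamma b / Real.Gamma (a + b) := by
  have h : Complex.betaIntegral a b
      = ((∫ t in Set.Ioc (0 : ℝ) 1, t ^ (a - 1) * (1 - t) ^ (b - 1) : ℝ) : ℂ) := by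
    rw [Complex.betaIntegral, intervalIntegral.integral_of_le (by norm_num), ← integral_complex_ofReal]
    refine setIntegral_congr_fun measurableSet_Ioc fun t ht => ?_
    push_cast
    rw [Complex.ofReal_cpow ht.1.le, Complex.ofReal_cpow (by linarith [ht.2])]
    push_cast
    rfl
  have h2 := ProbabilityTheory.beta_eq_betaIntegralReal a b ha hb
  rw [h, Complex.ofReal_re] at h2
  rw [← h2, ProbabilityTheory.beta]

lemma Gamma_mul_Gamma_le {a b : ℝ} (ha : 1 ≤ a) (hb : 1 ≤ b) :
    Real.Gamma a * Real.Gamma b ≤ Real.Gamma (a + b) := by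
  have h := integral_beta (a := a) (b := b) (by linarith) (by linarith)
  have hle : ∫ t in Set.Ioc (0 : ℝ) 1, t ^ (a - 1) * (1 - t) ^ (b - 1)
      ≤ ∫ _ in Set.Ioc (0 : ℝ) 1, (1 : ℝ) := by
    refine setIntegral_mono_on (integrableOn_beta (by linarith) (by linarith)) (by simp)
      measurableSet_Ioc fun t ht => ?_
    exact mul_le_one₀ (rpow_le_one ht.1.le ht.2 (by linarith))
      (rpow_nonneg (by linarith [ht.2]) _)
      (rpow_le_one (by linarith [ht.2]) (by linarith [ht.1]) (by linarith))
  rw [h] at hle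
  simpa [div_le_one (Real.Gamma_pos_of_pos (show 0 < a + b by linarith))] using hle

/-- The general term of the regularized confluent hypergeometric series. -/
def kummerTerm (A B y : ℝ) (i : ℕ) : ℝ :=
  (-y) ^ i * Real.Gamma (A + i) / (i.factorial * Real.Gamma (B + i))

/-- The regularized confluent hypergeometric function `Γ(A) ₁F₁(A; B; -y) / Γ(B)`. -/
def kummer (A B y : ℝ) : ℝ := ∑' i, kummerTerm A B y i

lemma Gamma_ratio_le {A B : ℝ} (hA : 0 < A) (hB : 0 < B) (i : ℕ) :
    Real.Gamma (A + i) / Real.Gamma (B + i)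
      ≤ Real.Gamma A / Real.Gamma B * (1 + A / B) ^ i := by
  induction i with
  | zero => simp
  | succ i ih =>
    have h1 : Real.Gamma (A + (i + 1 : ℕ)) = (A + i) * Real.Gamma (A + i) := by
      rw [← Real.Gamma_add_one (by positivity)]; push_cast; ring_nf
    have h2 : Real.Gamma (B + (i + 1 : ℕ)) = (B + i) * Real.Gamma (B + i) := by
      rw [← Real.Gamma_add_one (by positivity)]; push_cast; ring_nf
    rw [h1, h2, mul_div_mul_comm, pow_succ, ← mul_assoc, mul_comm]
    have h3 : (A + i) / (B + i) ≤ 1 + A / B := by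
      rw [div_le_iff₀ (by positivity)]
      have : (1 + A / B) * (B + i) = B + i + A + A * i / B := by field_simp; ring
      rw [this]
      have : 0 ≤ A * i / B := by positivity
      linarith
    have h4 : 0 < Real.Gamma (A + i) := Real.Gamma_pos_of_pos (by positivity)
    have h5 : 0 < Real.Gamma (B + i) := Real.Gamma_pos_of_pos (by positivity)
    exact mul_le_mul ih h3 (by positivity) (le_trans (by positivity) ih)

lemma summable_kummerTerm {A B : ℝ} (hA : 0 < A) (hB : 0 < B) (y : ℝ) :
    Summable (kummerTerm A B y) := by
  refine Summable.of_norm_bounded (g := fun i : ℕ => Real.Gamma A / Real.Gamma B *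
    ((|y| * (1 + A / B)) ^ i / i.factorial))
    ((Real.summable_pow_div_factorial _).mul_left _) fun i => ?_
  have h4 : 0 < Real.Gamma (A + i) := Real.Gamma_pos_of_pos (by positivity)
  have h5 : 0 < Real.Gamma (B + i) := Real.Gamma_pos_of_pos (by positivity)
  have e : ‖kummerTerm A B y i‖
      = |y| ^ i / i.factorial * (Real.Gamma (A + i) / Real.Gamma (B + i)) := by
    rw [kummerTerm, Real.norm_eq_abs, abs_div, abs_mul, abs_mul, abs_pow, abs_neg,
      abs_of_pos h4, abs_of_pos h5, Nat.abs_cast, mul_div_mul_comm]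
  rw [e, mul_pow]
  calc _ ≤ |y| ^ i / i.factorial * (Real.Gamma A / Real.Gamma B * (1 + A / B) ^ i) := by
        gcongr; exact Gamma_ratio_le hA hB i
    _ = _ := by ring

lemma kummer_eq {A B : ℝ} (hA : 0 < A) (hB : 0 < B) (y : ℝ) :
    kummer A B y = B * kummer A (B + 1) y - y * kummer (A + 1) (B + 2) y := by
  have hs := summable_kummerTerm hA (show 0 < B + 1 by linarith) y
  have hs2 := summable_kummerTerm (show 0 < A + 1 by linarith) (show 0 < B + 2 by linarith) y
  have hshift : HasSum (fun i : ℕ => (i : ℝ) * kummerTerm A (B + 1) y i)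
      (-y * kummer (A + 1) (B + 2) y) := by
    rw [← hasSum_nat_add_iff' 1]
    simp only [Finset.range_one, Finset.sum_singleton, Nat.cast_zero, zero_mul, sub_zero]
    refine (hs2.hasSum.mul_left (-y)).congr_fun ?_
    intro i
    simp only [kummerTerm]
    have : (i + 1).factorial = (i + 1) * i.factorial := rfl
    rw [this, pow_succ]
    push_cast
    have e1 : A + ((i : ℝ) + 1) = A + 1 + i := by ring
    have e2 : B + 1 + ((i : ℝ) + 1) = B + 2 + i := by ring
    rw [e1, e2]
    have : Real.Gamma (B + 2 + i) ≠ 0 := (Real.Gamma_pos_of_pos (by positivity)).ne'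
    field_simp
  have htot := (hs.hasSum.mul_left B).add hshift
  have : B * kummer A (B + 1) y - y * kummer (A + 1) (B + 2) y =
    B * kummer A (B + 1) y + -y * kummer (A + 1) (B + 2) y := by ring
  rw [this]
  refine HasSum.tsum_eq (htot.congr_fun fun i => ?_)
  simp only [kummerTerm]
  have e : Real.Gamma (B + 1 + i) = (B + i) * Real.Gamma (B + i) := by
    rw [← Real.Gamma_add_one (by positivity)]; ring_nf
  rw [e]
  have : Real.Gamma (B + i) ≠ 0 := (Real.Gamma_pos_of_pos (by positivity)).ne'
  have : B + i ≠ 0 := by positivity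
  field_simp

lemma kummer_integral {A B y : ℝ} (hA : 0 < A) (hc : 0 < B - A) :
    Real.Gamma (B - A) * kummer A B y
      = ∫ t in Set.Ioc (0 : ℝ) 1, t ^ (A - 1) * (1 - t) ^ (B - A - 1) * rexp (-y * t) := by
  set F : ℕ → ℝ → ℝ := fun i t =>
    (-y) ^ i / i.factorial * (t ^ (A + i - 1) * (1 - t) ^ (B - A - 1)) with hF
  have hB : 0 < B := by linarith
  have hGc := (Real.Gamma_pos_of_pos hc)
  have hb (i : ℕ) : ∫ t in Set.Ioc (0 : ℝ) 1, t ^ (A + i - 1) * (1 - t) ^ (B - A - 1)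
      = Real.Gamma (A + i) * Real.Gamma (B - A) / Real.Gamma (B + i) := by
    rw [integral_beta (by positivity) hc]
    congr 2; ring
  have hint (i : ℕ) : Integrable (F i) (volume.restrict (Set.Ioc 0 1)) :=
    (integrableOn_beta (a := A + i) (by positivity) hc).const_mul _
  have hval (i : ℕ) : ∫ t in Set.Ioc (0 : ℝ) 1, F i t
      = Real.Gamma (B - A) * kummerTerm A B y i := by
    simp only [hF]
    rw [integral_const_mul, hb, kummerTerm]
    ring
  have hnorm (i : ℕ) : ∫ t in Set.Ioc (0 : ℝ) 1, ‖F i t‖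
      = Real.Gamma (B - A) * kummerTerm A B (-|y|) i := by
    have : ∫ t in Set.Ioc (0 : ℝ) 1, ‖F i t‖ = ∫ t in Set.Ioc (0 : ℝ) 1,
        |y| ^ i / i.factorial * (t ^ (A + i - 1) * (1 - t) ^ (B - A - 1)) := by
      refine setIntegral_congr_fun measurableSet_Ioc fun t ht => ?_
      simp only [hF]
      rw [norm_mul, norm_mul, norm_div, norm_pow, norm_neg, Real.norm_eq_abs, Real.norm_natCast,
        Real.norm_of_nonneg (rpow_nonneg ht.1.le _),
        Real.norm_of_nonneg (rpow_nonneg (by linarith [ht.2]) _)]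
    rw [this, integral_const_mul, hb, kummerTerm, neg_neg]
    ring
  have hs := hasSum_integral_of_summable_integral_norm hint (by
    simp_rw [hnorm]
    exact (summable_kummerTerm hA hB _).mul_left _)
  simp_rw [hval] at hs
  rw [kummer, ← tsum_mul_left, hs.tsum_eq]
  refine setIntegral_congr_fun measurableSet_Ioc fun t ht => ?_
  have he : HasSum (fun i : ℕ => (-y * t) ^ i / i.factorial) (rexp (-y * t)) := by
    rw [Real.exp_eq_exp_ℝ]
    exact NormedSpace.expSeries_div_hasSum_exp _
  rw [← he.tsum_eq, ← tsum_mul_left]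
  refine tsum_congr fun i => ?_
  simp only [hF]
  have : t ^ (A + i - 1) = t ^ (A - 1) * t ^ i := by
    rw [← rpow_natCast t i, ← rpow_add ht.1]; congr 1; ring
  rw [this, mul_pow]
  ring

lemma integrableOn_rpow_mul_exp {a y : ℝ} (ha : 0 < a) (hy : 0 < y) :
    IntegrableOn (fun t : ℝ => t ^ (a - 1) * rexp (-(y * t))) (Set.Ioi 0) := by
  have := integrableOn_rpow_mul_exp_neg_mul_rpow (p := 1) (s := a - 1) (b := y)
    (by linarith) one_pos hy
  simpa using this

lemma integral_rpow_mul_exp {a y : ℝ} (ha : 0 < a) (hy : 0 < y) :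
    ∫ t in Set.Ioi (0 : ℝ), t ^ (a - 1) * rexp (-(y * t)) = Real.Gamma a * y ^ (-a) := by
  rw [integral_rpow_mul_exp_neg_mul_Ioi ha hy, one_div, inv_rpow hy.le, rpow_neg hy.le, mul_comm]

lemma kummer_bounds {A B y : ℝ} (hA : 0 < A) (hc : 2 ≤ B - A) (hy : 0 < y) :
    0 ≤ y ^ A * kummer A B y ∧
    y ^ A * kummer A B y ≤ Real.Gamma A / Real.Gamma (B - A) ∧
    Real.Gamma A / Real.Gamma (B - A) * (1 - (B - A - 1) * A / y) ≤ y ^ A * kummer A B y := by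
  have hk := kummer_integral (y := y) hA (by linarith : 0 < B - A)
  have hG : 0 < Real.Gamma (B - A) := Real.Gamma_pos_of_pos (by linarith)
  have hyA : y ^ A * y ^ (-A) = 1 := by rw [← rpow_add hy]; simp
  have hyA' : 0 < y ^ A := rpow_pos_of_pos hy _
  set I := ∫ t in Set.Ioc (0 : ℝ) 1, t ^ (A - 1) * (1 - t) ^ (B - A - 1) * rexp (-y * t) with hI
  have hi1 := integrableOn_rpow_mul_exp hA hy
  have hi2 := integrableOn_rpow_mul_exp (show 0 < A + 1 by linarith) hy
  have hint : IntegrableOn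
      (fun t => t ^ (A - 1) * (1 - t) ^ (B - A - 1) * rexp (-y * t)) (Set.Ioc (0 : ℝ) 1) := by
    refine Integrable.mono' (integrableOn_beta hA (show 0 < B - A by linarith))
      (by fun_prop) ((ae_restrict_iff' measurableSet_Ioc).2 (ae_of_all _ fun t ht => ?_))
    have h0 : 0 ≤ t ^ (A - 1) * (1 - t) ^ (B - A - 1) :=
      mul_nonneg (rpow_nonneg ht.1.le _) (rpow_nonneg (by linarith [ht.2]) _)
    rw [norm_mul, Real.norm_of_nonneg h0, Real.norm_of_nonneg (exp_pos _).le]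
    exact mul_le_of_le_one_right h0 (exp_le_one_iff.2 (by nlinarith [ht.1]))
  have hnn : 0 ≤ I := setIntegral_nonneg measurableSet_Ioc fun t ht =>
    mul_nonneg (mul_nonneg (rpow_nonneg ht.1.le _) (rpow_nonneg (by linarith [ht.2]) _))
      (exp_pos _).le
  have hI0 : I = ∫ t in Set.Ioi (0 : ℝ), (Set.Ioc (0 : ℝ) 1).indicator
      (fun t => t ^ (A - 1) * (1 - t) ^ (B - A - 1) * rexp (-y * t)) t := by
    rw [setIntegral_indicator measurableSet_Ioc]
    rw [Set.inter_eq_self_of_subset_right Set.Ioc_subset_Ioi_self]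
  have hint0 : IntegrableOn (fun t => (Set.Ioc (0 : ℝ) 1).indicator
      (fun t => t ^ (A - 1) * (1 - t) ^ (B - A - 1) * rexp (-y * t)) t) (Set.Ioi 0) :=
    ((integrable_indicator_iff measurableSet_Ioc).2 hint).integrableOn
  have hup : I ≤ Real.Gamma A * y ^ (-A) := by
    rw [← integral_rpow_mul_exp hA hy, hI0]
    refine setIntegral_mono_on hint0 hi1 measurableSet_Ioi fun t ht => ?_
    have ht : 0 < t := ht
    by_cases h1 : t ∈ Set.Ioc (0 : ℝ) 1
    · rw [Set.indicator_of_mem h1, neg_mul]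
      refine mul_le_mul_of_nonneg_right (mul_le_of_le_one_right (rpow_nonneg ht.le _) ?_)
        (exp_pos _).le
      exact rpow_le_one (by linarith [h1.2]) (by linarith) (by linarith)
    · rw [Set.indicator_of_notMem h1]
      positivity
  have hlow : Real.Gamma A * y ^ (-A) - (B - A - 1) * (Real.Gamma (A + 1) * y ^ (-(A + 1))) ≤ I := by
    rw [← integral_rpow_mul_exp hA hy,
      ← integral_rpow_mul_exp (show 0 < A + 1 by linarith) hy, ← integral_const_mul,
      ← integral_sub hi1 (hi2.const_mul _), hI0]
    refine setIntegral_mono_on (hi1.sub (hi2.const_mul _)) hint0 measurableSet_Ioi fun t ht => ?_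
    have ht : 0 < t := ht
    have e : t ^ (A + 1 - 1) = t ^ (A - 1) * t := by
      nth_rewrite 3 [← rpow_one t]
      rw [← rpow_add ht]; congr 1; ring
    have e2 : t ^ (A - 1) * rexp (-(y * t)) - (B - A - 1) * (t ^ (A + 1 - 1) * rexp (-(y * t)))
      = t ^ (A - 1) * (1 - (B - A - 1) * t) * rexp (-y * t) := by rw [e]; ring_nf
    rw [e2]
    by_cases h1 : t ∈ Set.Ioc (0 : ℝ) 1
    · rw [Set.indicator_of_mem h1]
      have hb := one_add_mul_self_le_rpow_one_add (s := -t) (by linarith [h1.2])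
        (p := B - A - 1) (by linarith)
      have : 1 - (B - A - 1) * t ≤ (1 - t) ^ (B - A - 1) := by
        rw [sub_eq_add_neg 1 t]; linarith
      gcongr
    · rw [Set.indicator_of_notMem h1]
      have h1 : 1 < t := by
        by_contra h
        exact h1 ⟨ht, not_lt.1 h⟩
      refine mul_nonpos_of_nonpos_of_nonneg (mul_nonpos_of_nonneg_of_nonpos
        (rpow_nonneg ht.le _) ?_) (exp_pos _).le
      nlinarith
  have hk' : kummer A B y = I / Real.Gamma (B - A) := by rw [← hk]; field_simp
  rw [hk', ← mul_div_assoc]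
  refine ⟨by positivity, ?_, ?_⟩
  · rw [div_le_div_iff_of_pos_right hG]
    calc y ^ A * I ≤ y ^ A * (Real.Gamma A * y ^ (-A)) := by gcongr
      _ = Real.Gamma A * (y ^ A * y ^ (-A)) := by ring
      _ = _ := by rw [hyA, mul_one]
  · rw [div_mul_eq_mul_div, div_le_div_iff_of_pos_right hG]
    calc _ = y ^ A * (Real.Gamma A * y ^ (-A)
          - (B - A - 1) * (Real.Gamma (A + 1) * y ^ (-(A + 1)))) := by
          rw [Real.Gamma_add_one hA.ne', neg_add, ← sub_eq_add_neg, rpow_sub_one hy.ne']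
          have : y ^ A * (Real.Gamma A * y ^ (-A) -
              (B - A - 1) * (A * Real.Gamma A * (y ^ (-A) / y)))
            = (y ^ A * y ^ (-A)) * (Real.Gamma A * (1 - (B - A - 1) * A / y)) := by
            field_simp
          rw [this, hyA, one_mul]
      _ ≤ _ := by gcongr

lemma Gamma_div_recurrence (A c : ℝ) (hA : A ≠ 0) :
    (A + c) * (Real.Gamma A / Real.Gamma (c + 1)) - Real.Gamma (A + 1) / Real.Gamma (c + 1)
      = Real.Gamma A / Real.Gamma c := by
  rw [Real.Gamma_add_one hA]
  by_cases hc : c = 0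
  · subst hc
    simp
  · rw [Real.Gamma_add_one hc]
    by_cases h : Real.Gamma c = 0
    · simp [h]
    · field_simp; ring

lemma tendsto_kummer (N : ℕ) : ∀ {A B : ℝ}, 0 < A → 0 < B → 2 ≤ B - A + N →
    Tendsto (fun y => y ^ A * kummer A B y) atTop (𝓝 (Real.Gamma A / Real.Gamma (B - A))) := by
  induction N with
  | zero =>
    intro A B hA hB h
    have h : 2 ≤ B - A := by simpa using h
    refine tendsto_of_tendsto_of_tendsto_of_le_of_le' (g := fun y : ℝ =>
      Real.Gamma A / Real.Gamma (B - A) * (1 - (B - A - 1) * A / y)) ?_ tendsto_const_nhds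
      ?_ ?_
    · have : Tendsto (fun y : ℝ => (B - A - 1) * A / y) atTop (𝓝 0) :=
        tendsto_const_nhds.div_atTop tendsto_id
      simpa using ((tendsto_const_nhds (x := (1 : ℝ))).sub this).const_mul (Real.Gamma A / Real.Gamma (B - A))
    · filter_upwards [eventually_gt_atTop 0] with y hy using (kummer_bounds hA h hy).2.2
    · filter_upwards [eventually_gt_atTop 0] with y hy using (kummer_bounds hA h hy).2.1
  | succ N ih =>
    intro A B hA hB h
    push_cast at h
    have h1 := ih hA (show 0 < B + 1 by linarith) (by linarith)
    have h2 := ih (show 0 < A + 1 by linarith) (show 0 < B + 2 by linarith) (by linarith)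
    have h3 := (h1.const_mul B).sub h2
    have e1 : B + 1 - A = B - A + 1 := by ring
    have e2 : B + 2 - (A + 1) = B - A + 1 := by ring
    have e3 := Gamma_div_recurrence A (B - A) hA.ne'
    rw [add_sub_cancel] at e3
    rw [e1, e2, e3] at h3
    refine h3.congr' ?_
    filter_upwards [eventually_gt_atTop 0] with y hy
    rw [kummer_eq hA hB, rpow_add_one hy.ne']
    ring

lemma abs_kummer_le (N : ℕ) : ∀ {A B y : ℝ}, 0 < A → 0 < B → 2 ≤ B - A + N → 0 < y →
    |y ^ A * kummer A B y|
      ≤ Real.Gamma A / Real.Gamma (B - A + N) * ∏ i ∈ Finset.range N, (A + B + 3 * i) := by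
  induction N with
  | zero =>
    intro A B y hA hB h hy
    have h : 2 ≤ B - A := by simpa using h
    have := kummer_bounds hA h hy
    rw [abs_of_nonneg this.1]
    simpa using this.2.1
  | succ N ih =>
    intro A B y hA hB h hy
    push_cast at h
    have h1 := ih hA (show 0 < B + 1 by linarith) (by linarith) hy
    have h2 := ih (show 0 < A + 1 by linarith) (show 0 < B + 2 by linarith) (by linarith) hy
    have e : y ^ A * kummer A B y
        = B * (y ^ A * kummer A (B + 1) y) - y ^ (A + 1) * kummer (A + 1) (B + 2) y := by
      rw [kummer_eq hA hB, rpow_add_one hy.ne']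
      ring
    have hG : 0 < Real.Gamma (B - A + (N + 1)) := Real.Gamma_pos_of_pos (by linarith)
    have hGA := Real.Gamma_pos_of_pos hA
    have e1 : B + 1 - A + N = B - A + (N + 1) := by ring
    have e2 : B + 2 - (A + 1) + N = B - A + (N + 1) := by ring
    rw [e1] at h1
    rw [e2, Real.Gamma_add_one hA.ne'] at h2
    push_cast
    rw [Finset.prod_range_succ']
    have hp1 : ∏ i ∈ Finset.range N, (A + (B + 1) + 3 * (i : ℝ))
        ≤ ∏ i ∈ Finset.range N, (A + B + 3 * ((i + 1 : ℕ) : ℝ)) := by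
      refine Finset.prod_le_prod (fun i _ => by positivity) fun i _ => ?_
      push_cast; linarith
    have hp2 : ∏ i ∈ Finset.range N, (A + 1 + (B + 2) + 3 * (i : ℝ))
        = ∏ i ∈ Finset.range N, (A + B + 3 * ((i + 1 : ℕ) : ℝ)) := by
      refine Finset.prod_congr rfl fun i _ => ?_
      push_cast; ring
    rw [hp2] at h2
    set Q := ∏ i ∈ Finset.range N, (A + B + 3 * ((i + 1 : ℕ) : ℝ)) with hQ
    set G := Real.Gamma (B - A + (N + 1)) with hGdef
    calc |y ^ A * kummer A B y| ≤ B * |y ^ A * kummer A (B + 1) y|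
          + |y ^ (A + 1) * kummer (A + 1) (B + 2) y| := by
          rw [e]
          refine (abs_sub _ _).trans ?_
          rw [abs_mul B, abs_of_pos hB]
      _ ≤ B * (Real.Gamma A / G * Q) + A * Real.Gamma A / G * Q := by
          gcongr
          exact h1.trans (by gcongr)
      _ = _ := by
          simp only [Nat.cast_zero, mul_zero, add_zero]
          ring

lemma rpow_mul_exp_le_Gamma {R x : ℝ} (hR : 0 < R) (hx : 1 ≤ x) :
    rexp (-(R + 1)) * R ^ (x - 1) ≤ Real.Gamma x := by
  have hx0 : 0 < x := by linarith
  rw [Real.Gamma_eq_integral hx0]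
  have hconv := Real.GammaIntegral_convergent hx0
  have hsub : Set.Ioc R (R + 1) ⊆ Set.Ioi 0 := fun t ht => lt_trans hR ht.1
  calc rexp (-(R + 1)) * R ^ (x - 1)
      = ∫ _ in Set.Ioc R (R + 1), rexp (-(R + 1)) * R ^ (x - 1) := by simp
    _ ≤ ∫ t in Set.Ioc R (R + 1), rexp (-t) * t ^ (x - 1) := by
        refine setIntegral_mono_on (continuous_const.integrableOn_Ioc) (hconv.mono_set hsub)
          measurableSet_Ioc fun t ht => ?_
        exact mul_le_mul (exp_le_exp.2 (by linarith [ht.2]))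
          (rpow_le_rpow hR.le ht.1.le (by linarith)) (rpow_nonneg hR.le _) (exp_pos _).le
    _ ≤ _ := by
        refine setIntegral_mono_set hconv ?_ hsub.eventuallyLE
        refine (ae_restrict_iff' measurableSet_Ioi).2 (ae_of_all _ fun t ht => ?_)
        exact mul_nonneg (exp_pos _).le (rpow_nonneg (le_of_lt ht) _)

lemma summable_pow_div_Gamma {C β γ : ℝ} (hC : 0 ≤ C) (hβ : 0 < β) (hγ : 1 ≤ γ) :
    Summable (fun k : ℕ => C ^ k / Real.Gamma (k * β + γ)) := by
  set R : ℝ := (2 * C + 1) ^ (1 / β) with hR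
  have hR0 : 0 < R := rpow_pos_of_pos (by linarith) _
  have hRβ : R ^ β = 2 * C + 1 := by
    rw [hR, ← rpow_mul (by linarith), one_div, inv_mul_cancel₀ hβ.ne', rpow_one]
  have hr : C / (2 * C + 1) < 1 := by rw [div_lt_one (by linarith)]; linarith
  refine Summable.of_nonneg_of_le (fun k => ?_) (fun k => ?_)
    ((summable_geometric_of_lt_one (by positivity) hr).mul_left
      (rexp (R + 1) * R ^ (1 - γ)))
  · have : 0 < Real.Gamma (k * β + γ) := Real.Gamma_pos_of_pos (by positivity)
    positivity
  · have hx : 1 ≤ k * β + γ := by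
      have : 0 ≤ k * β := by positivity
      linarith
    have h := rpow_mul_exp_le_Gamma hR0 hx
    have hpos : 0 < rexp (-(R + 1)) * R ^ (k * β + γ - 1) := by positivity
    calc C ^ k / Real.Gamma (k * β + γ)
        ≤ C ^ k / (rexp (-(R + 1)) * R ^ (k * β + γ - 1)) := by gcongr
      _ = _ := by
        have e : R ^ (k * β + γ - 1) = (2 * C + 1) ^ k * (R ^ (1 - γ))⁻¹ := by
          rw [← hRβ, ← rpow_natCast, ← rpow_mul hR0.le, ← rpow_neg hR0.le, ← rpow_add hR0]
          congr 1; ring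
        rw [e, exp_neg, div_pow]
        have : R ^ (1 - γ) ≠ 0 := by positivity
        field_simp

lemma kummer_coeff_bound {d q j k : ℕ} {α y : ℝ} (hd : 2 ≤ d) (hα0 : 0 < α) (hα1 : α < 1)
    (hj : j ≤ k * q) (hy : 0 < y) :
    |y ^ (((j : ℝ) + k * α + d) / 2) * kummer (((j : ℝ) + k * α + d) / 2) (j + (d : ℝ) / 2) y|
        / k.factorial
      ≤ d.factorial * (2 * ((2 * q + 4) * rexp 1)) ^ (k + d) /
        Real.Gamma (k * (1 - α) + (d : ℝ) / 2) := by
  set A : ℝ := ((j : ℝ) + k * α + d) / 2 with hA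
  set B : ℝ := j + (d : ℝ) / 2 with hB
  set Z : ℝ := k * (1 - α) + (d : ℝ) / 2 with hZ
  have hd' : (2 : ℝ) ≤ d := by exact_mod_cast hd
  have hkα : k * α ≤ k := by nlinarith [Nat.cast_nonneg (α := ℝ) k]
  have hk1 : 0 ≤ k * α := by positivity
  have hk2 : 0 ≤ k * (1 - α) := mul_nonneg (by positivity) (by linarith)
  have hj0 : (0 : ℝ) ≤ j := by positivity
  have hk0 : (0 : ℝ) ≤ k := by positivity
  have hq0 : (0 : ℝ) ≤ q := by positivity
  have hA1 : 1 ≤ A := by rw [hA]; linarith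
  have hB0 : 0 < B := by rw [hB]; linarith
  have hZ1 : 1 ≤ Z := by rw [hZ]; linarith
  have hN : (2 : ℝ) ≤ B - A + (k + d : ℕ) := by rw [hA, hB]; push_cast; linarith
  have h := abs_kummer_le (k + d) (by linarith : 0 < A) hB0 hN hy
  have hsum : A + Z = B - A + (k + d : ℕ) := by rw [hA, hB, hZ]; push_cast; ring
  have hG := Gamma_mul_Gamma_le hA1 hZ1
  rw [hsum] at hG
  have hGZ : 0 < Real.Gamma Z := Real.Gamma_pos_of_pos (by linarith)
  have hGA : 0 < Real.Gamma A := Real.Gamma_pos_of_pos (by linarith)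
  have hGN : 0 < Real.Gamma (B - A + (k + d : ℕ)) := Real.Gamma_pos_of_pos (by linarith)
  have h1 : Real.Gamma A / Real.Gamma (B - A + (k + d : ℕ)) ≤ 1 / Real.Gamma Z := by
    rw [div_le_div_iff₀ hGN hGZ]; linarith
  have hprod : ∏ i ∈ Finset.range (k + d), (A + B + 3 * (i : ℝ))
      ≤ ((2 * q + 4) * ((k + d : ℕ) : ℝ)) ^ (k + d) := by
    calc _ ≤ ∏ _i ∈ Finset.range (k + d), ((2 * q + 4) * ((k + d : ℕ) : ℝ)) := by
          refine Finset.prod_le_prod (fun i _ => by positivity) fun i hi => ?_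
          have hi' : (i : ℝ) ≤ k + d := by exact_mod_cast (Finset.mem_range.1 hi).le
          have hj' : (j : ℝ) ≤ k * q := by exact_mod_cast hj
          have hdq : 0 ≤ (d : ℝ) * q := by positivity
          rw [hA, hB]; push_cast
          nlinarith
      _ = _ := by simp
  have hfac : ((k + d : ℕ) : ℝ) ^ (k + d) ≤ rexp 1 ^ (k + d) * (k + d).factorial := by
    have := Real.pow_div_factorial_le_exp ((k + d : ℕ) : ℝ) (by positivity) (k + d)
    rw [div_le_iff₀ (by positivity)] at this
    refine this.trans_eq ?_
    rw [← Real.exp_nat_mul, mul_one]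
  have hfac2 : ((k + d).factorial : ℝ) ≤ 2 ^ (k + d) * k.factorial * d.factorial := by
    have e : (k + d).choose k * k.factorial * d.factorial = (k + d).factorial := by
      have := Nat.choose_mul_factorial_mul_factorial (Nat.le_add_right k d)
      simpa using this
    rw [← e]
    push_cast
    gcongr
    exact_mod_cast Nat.choose_le_two_pow (k + d) k
  rw [div_le_div_iff₀ (by positivity) hGZ]
  calc |y ^ A * kummer A B y| * Real.Gamma Z
      ≤ (1 / Real.Gamma Z * ((2 * q + 4) * ((k + d : ℕ) : ℝ)) ^ (k + d)) * Real.Gamma Z := by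
        gcongr
        exact h.trans (mul_le_mul h1 hprod
          (Finset.prod_nonneg fun i _ => by positivity) (by positivity))
    _ = (2 * q + 4) ^ (k + d) * ((k + d : ℕ) : ℝ) ^ (k + d) := by
        rw [mul_pow]; field_simp
    _ ≤ (2 * q + 4) ^ (k + d) * (rexp 1 ^ (k + d) * (2 ^ (k + d) * k.factorial * d.factorial)) := by
        gcongr
        exact hfac.trans (by gcongr)
    _ = _ := by rw [mul_pow, mul_pow]; ring

open Polynomial in
/-- The ultraspherical polynomials normalised to take the value `1` at `1`. -/
def ultra (b : ℝ) : ℕ → Polynomial ℝ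
  | 0 => 1
  | 1 => X
  | j + 2 => C (2 * (j + 1 + b) / (j + 1 + 2 * b)) * (X * ultra b (j + 1))
      - C ((j + 1) / (j + 1 + 2 * b)) * ultra b j

lemma ultra_rec {b : ℝ} (hb : 0 ≤ b) (j : ℕ) (t : ℝ) :
    (j + 1 + 2 * b) * (ultra b (j + 2)).eval t
      = 2 * (j + 1 + b) * (t * (ultra b (j + 1)).eval t) - (j + 1) * (ultra b j).eval t := by
  have : (j : ℝ) + 1 + 2 * b ≠ 0 := by positivity
  simp only [ultra, Polynomial.eval_sub, Polynomial.eval_mul, Polynomial.eval_C,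
    Polynomial.eval_X]
  field_simp

lemma ultra_eval_one {b : ℝ} (hb : 0 ≤ b) (j : ℕ) : (ultra b j).eval 1 = 1 := by
  induction j using Nat.twoStepInduction with
  | zero => simp [ultra]
  | one => simp [ultra]
  | more j h0 h1 =>
    have h := ultra_rec hb j 1
    have hne : (j : ℝ) + 1 + 2 * b ≠ 0 := by positivity
    rw [h0, h1] at h
    refine mul_left_cancel₀ hne (h.trans ?_)
    ring

lemma abs_ultra_eval_le {b : ℝ} (hb : 0 ≤ b) (j : ℕ) {t : ℝ} (ht : |t| ≤ 1) :
    |(ultra b j).eval t| ≤ 3 ^ j := by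
  induction j using Nat.twoStepInduction with
  | zero => simp [ultra]
  | one => simpa [ultra] using ht.trans (by norm_num)
  | more j h0 h1 =>
    have h := ultra_rec hb j t
    have hpos : (0 : ℝ) < j + 1 + 2 * b := by positivity
    refine le_of_mul_le_mul_left ?_ hpos
    rw [← abs_of_pos hpos, ← abs_mul, abs_of_pos hpos, h]
    have e1 : |t * (ultra b (j + 1)).eval t| ≤ 3 ^ (j + 1) := by
      rw [abs_mul]
      exact (mul_le_of_le_one_left (abs_nonneg _) ht).trans h1
    refine (abs_sub _ _).trans ?_
    rw [abs_mul, abs_mul ((j : ℝ) + 1), abs_of_nonneg (by positivity : 0 ≤ 2 * ((j : ℝ) + 1 + b)),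
      abs_of_nonneg (by positivity : 0 ≤ (j : ℝ) + 1)]
    have h3 : (0 : ℝ) < 3 ^ j := by positivity
    calc _ ≤ 2 * ((j : ℝ) + 1 + b) * 3 ^ (j + 1) + ((j : ℝ) + 1) * 3 ^ j := by gcongr
      _ ≤ _ := by
        rw [pow_succ, pow_add]
        nlinarith [mul_nonneg hb h3.le, mul_nonneg (Nat.cast_nonneg (α := ℝ) j) h3.le]

/-- The `m`-th summand of the explicit formula for the Gegenbauer polynomial, extended by zero. -/
def gegTerm (b : ℝ) (j : ℕ) (t : ℝ) (m : ℕ) : ℝ :=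
  if 2 * m ≤ j then (-1 : ℝ) ^ m * 2 ^ (j - 2 * m) * risingFactorial b (j - m) /
      ((Nat.factorial m : ℝ) * (Nat.factorial (j - 2 * m) : ℝ)) * t ^ (j - 2 * m) else 0

lemma gegenbauer_eq_sum (b : ℝ) (j : ℕ) (t : ℝ) {N : ℕ} (hN : j / 2 + 1 ≤ N) :
    gegenbauer b j t = ∑ m ∈ Finset.range N, gegTerm b j t m := by
  rw [← Finset.sum_subset (Finset.range_subset_range.2 hN)]
  · refine Finset.sum_congr rfl fun m hm => ?_
    rw [gegTerm, if_pos]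
    have := Finset.mem_range.1 hm
    omega
  · intro m _ hm
    rw [gegTerm, if_neg]
    simp only [Finset.mem_range] at hm
    omega

lemma risingFactorial_succ (b : ℝ) (n : ℕ) :
    risingFactorial b (n + 1) = risingFactorial b n * (b + n) := by
  simp [risingFactorial, Finset.prod_range_succ]

lemma gegTerm_rec_zero (b : ℝ) (j : ℕ) (t : ℝ) :
    (j + 2) * gegTerm b (j + 2) t 0 = 2 * (j + 1 + b) * (t * gegTerm b (j + 1) t 0) := by
  simp only [gegTerm, mul_zero, zero_le, if_true, Nat.sub_zero]
  rw [show j + 2 = (j + 1) + 1 from rfl, risingFactorial_succ, Nat.factorial_succ]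
  push_cast
  field_simp
  ring

lemma gegTerm_rec_succ (b : ℝ) (j : ℕ) (t : ℝ) (m : ℕ) :
    (j + 2) * gegTerm b (j + 2) t (m + 1)
      = 2 * (j + 1 + b) * (t * gegTerm b (j + 1) t (m + 1)) - (j + 2 * b) * gegTerm b j t m := by
  by_cases h : 2 * m ≤ j
  · obtain ⟨n, rfl⟩ := Nat.exists_eq_add_of_le h
    rcases n with _ | n
    · simp only [gegTerm]
      rw [if_pos (by omega), if_neg (by omega), if_pos (by omega)]
      rw [show 2 * m + 0 + 2 - 2 * (m + 1) = 0 by omega, show 2 * m + 0 - 2 * m = 0 by omega,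
        show 2 * m + 0 + 2 - (m + 1) = m + 1 by omega, show 2 * m + 0 - m = m by omega,
        risingFactorial_succ, Nat.factorial_succ]
      push_cast
      field_simp
      ring
    · simp only [gegTerm]
      rw [if_pos (by omega), if_pos (by omega), if_pos (by omega)]
      rw [show 2 * m + (n + 1) + 2 - 2 * (m + 1) = n + 1 by omega,
        show 2 * m + (n + 1) - 2 * m = n + 1 by omega,
        show 2 * m + (n + 1) + 1 - 2 * (m + 1) = n by omega,
        show 2 * m + (n + 1) + 2 - (m + 1) = m + n + 1 + 1 by omega,
        show 2 * m + (n + 1) - m = m + n + 1 by omega,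
        show 2 * m + (n + 1) + 1 - (m + 1) = m + n + 1 by omega,
        risingFactorial_succ _ (m + n + 1), Nat.factorial_succ, Nat.factorial_succ]
      push_cast
      field_simp
      ring
  · simp only [gegTerm]
    rw [if_neg (by omega), if_neg (by omega), if_neg (by omega)]
    ring

lemma gegenbauer_rec (b : ℝ) (j : ℕ) (t : ℝ) :
    (j + 2) * gegenbauer b (j + 2) t
      = 2 * (j + 1 + b) * (t * gegenbauer b (j + 1) t) - (j + 2 * b) * gegenbauer b j t := by
  rw [gegenbauer_eq_sum b (j + 2) t (N := j + 3) (by omega),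
    gegenbauer_eq_sum b (j + 1) t (N := j + 3) (by omega),
    gegenbauer_eq_sum b j t (N := j + 2) (by omega), Finset.sum_range_succ',
    Finset.sum_range_succ' (fun m => gegTerm b (j + 1) t m)]
  have h : (j + 2) * ∑ m ∈ Finset.range (j + 2), gegTerm b (j + 2) t (m + 1)
      = 2 * (j + 1 + b) * (t * ∑ m ∈ Finset.range (j + 2), gegTerm b (j + 1) t (m + 1))
        - (j + 2 * b) * ∑ m ∈ Finset.range (j + 2), gegTerm b j t m := by
    simp only [Finset.mul_sum]
    rw [← Finset.sum_sub_distrib]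
    exact Finset.sum_congr rfl fun m _ => gegTerm_rec_succ b j t m
  linear_combination h + gegTerm_rec_zero b j t

lemma gegenbauer_eq {b : ℝ} (hb : 0 ≤ b) (j : ℕ) (t : ℝ) :
    gegenbauer b j t = risingFactorial (2 * b) j / j.factorial * (ultra b j).eval t := by
  induction j using Nat.twoStepInduction with
  | zero => simp [gegenbauer, ultra, risingFactorial]
  | one => simp [gegenbauer, ultra, risingFactorial]
  | more j h0 h1 =>
    have hg := gegenbauer_rec b j t
    have hu := ultra_rec hb j t
    have hj : (j : ℝ) + 2 ≠ 0 := by positivity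
    refine mul_left_cancel₀ hj (hg.trans ?_)
    have r1 := risingFactorial_succ (2 * b) j
    have r2 : risingFactorial (2 * b) (j + 2) = _ := risingFactorial_succ (2 * b) (j + 1)
    rw [h0, h1, r2, r1, Nat.factorial_succ (j + 1), Nat.factorial_succ j]
    push_cast
    field_simp
    linear_combination (-(risingFactorial (2 * b) j * (2 * b + j) * (j + 2))) * hu

lemma risingFactorial_pos {b : ℝ} (hb : 0 < b) (n : ℕ) : 0 < risingFactorial b n :=
  Finset.prod_pos fun i _ => by positivity

lemma gegenbauerN_eq {b : ℝ} (hb : 0 ≤ b) (j : ℕ) (t : ℝ) :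
    gegenbauerN b j t = (ultra b j).eval t := by
  rw [gegenbauerN]
  split_ifs with h
  · subst h
    induction j using Nat.twoStepInduction with
    | zero => simp [ultra]
    | one => simp [ultra]
    | more j h0 h1 =>
      have hu := ultra_rec le_rfl j t
      have hj : (j : ℝ) + 1 ≠ 0 := by positivity
      have hT := Polynomial.Chebyshev.T_add_two ℝ (j : ℤ)
      push_cast at h0 h1 ⊢
      rw [hT]
      simp only [Polynomial.eval_sub, Polynomial.eval_mul, Polynomial.eval_X,
        Polynomial.eval_ofNat, h0, h1]
      refine mul_left_cancel₀ hj ?_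
      linear_combination -hu
  · have hb' : 0 < b := lt_of_le_of_ne hb (Ne.symm h)
    have := risingFactorial_pos (b := 2 * b) (by positivity) j
    rw [gegenbauer_eq hb, gegenbauer_eq hb, ultra_eval_one hb]
    field_simp

/-- The Funk–Hecke multiplier of `t ^ m` on spherical harmonics of degree `l`. -/
def monoMult (d m l : ℕ) : ℝ :=
  if l ≤ m ∧ Even (m - l) then
    2 * m.factorial * π ^ ((d : ℝ) / 2) * ((2 : ℝ) ^ l)⁻¹ * ((4 : ℝ) ^ ((m - l) / 2))⁻¹ /
      (((m - l) / 2).factorial * Real.Gamma (((m : ℝ) + l + d) / 2)) else 0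

lemma monoMult_add (d l i : ℕ) : monoMult d (l + 2 * i) l =
    2 * (l + 2 * i).factorial * π ^ ((d : ℝ) / 2) * ((2 : ℝ) ^ l)⁻¹ * ((4 : ℝ) ^ i)⁻¹ /
      (i.factorial * Real.Gamma (l + i + (d : ℝ) / 2)) := by
  rw [monoMult, if_pos ⟨by omega, by simp⟩, show (l + 2 * i - l) / 2 = i by omega]
  congr 3
  push_cast
  ring

lemma monoMult_eq_zero {d m l : ℕ} (h : ¬ (l ≤ m ∧ Even (m - l))) : monoMult d m l = 0 := by
  rw [monoMult, if_neg h]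

lemma monoMult_rec {d : ℕ} (hd : 2 ≤ d) (m l : ℕ) :
    2 * ((l : ℝ) + 1 + ((d : ℝ) - 2) / 2) * monoMult d (m + 1) (l + 1)
      = (l + 1) * monoMult d m l + (l + 1 + ((d : ℝ) - 2)) * monoMult d m (l + 2) := by
  have hd' : (2 : ℝ) ≤ d := by exact_mod_cast hd
  by_cases h : l ≤ m ∧ Even (m - l)
  · obtain ⟨h1, i, h2⟩ := h
    obtain rfl : m = l + 2 * i := by omega
    rcases i with _ | i
    · rw [monoMult_eq_zero (m := l + 2 * 0) (l := l + 2) (by omega), monoMult_add,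
        show l + 2 * 0 + 1 = (l + 1) + 2 * 0 by omega, monoMult_add]
      push_cast
      rw [show (l : ℝ) + 1 + 0 + d / 2 = l + 0 + d / 2 + 1 by ring,
        Real.Gamma_add_one (by positivity)]
      have : Real.Gamma ((l : ℝ) + 0 + d / 2) ≠ 0 := (Real.Gamma_pos_of_pos (by positivity)).ne'
      simp only [mul_zero, add_zero, Nat.factorial_succ] at *
      push_cast
      field_simp
      ring
    · have e : l + 2 * (i + 1) = (l + 2) + 2 * i := by ring
      rw [monoMult_add, show l + 2 * (i + 1) + 1 = (l + 1) + 2 * (i + 1) by omega, monoMult_add,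
        e, monoMult_add]
      push_cast
      rw [show (l : ℝ) + 1 + (i + 1) + d / 2 = l + (i + 1) + d / 2 + 1 by ring,
        show (l : ℝ) + 2 + i + d / 2 = l + (i + 1) + d / 2 + 1 by ring,
        Real.Gamma_add_one (by positivity)]
      have : Real.Gamma ((l : ℝ) + (i + 1) + d / 2) ≠ 0 :=
        (Real.Gamma_pos_of_pos (by positivity)).ne'
      rw [show l + 1 + 2 * (i + 1) = l + 2 + 2 * i + 1 by ring, Nat.factorial_succ (l + 2 + 2 * i),
        Nat.factorial_succ i]
      push_cast
      field_simp
      ring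
  · rw [monoMult_eq_zero h, monoMult_eq_zero (m := m + 1) (l := l + 1),
      monoMult_eq_zero (m := m) (l := l + 2)]
    · simp
    · rintro ⟨h1, i, h2⟩; exact h ⟨by omega, i + 1, by omega⟩
    · rintro ⟨h1, i, h2⟩; exact h ⟨by omega, i, by omega⟩

lemma monoMult_rec_zero {d : ℕ} (m : ℕ) :
    monoMult d (m + 1) 0 = monoMult d m 1 := by
  by_cases h : 1 ≤ m ∧ Even (m - 1)
  · obtain ⟨h1, i, h2⟩ := h
    obtain rfl : m = 1 + 2 * i := by omega
    rw [monoMult_add, show 1 + 2 * i + 1 = 0 + 2 * (i + 1) by omega, monoMult_add]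
    push_cast
    rw [show (0 : ℝ) + (i + 1) + d / 2 = 1 + i + d / 2 by ring,
      show 0 + 2 * (i + 1) = 1 + 2 * i + 1 by ring, Nat.factorial_succ (1 + 2 * i),
        Nat.factorial_succ i]
    have : Real.Gamma (1 + i + (d : ℝ) / 2) ≠ 0 := (Real.Gamma_pos_of_pos (by positivity)).ne'
    push_cast
    field_simp
    ring
  · rw [monoMult_eq_zero h, monoMult_eq_zero (m := m + 1) (l := 0)]
    rintro ⟨h1, i, h2⟩; exact h ⟨by omega, i - 1, by omega⟩

/-- The Funk–Hecke multiplier of a polynomial on spherical harmonics of degree `l`. -/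
def polyMult (d l : ℕ) (p : Polynomial ℝ) : ℝ := p.sum fun m a => a * monoMult d m l

lemma polyMult_add (d l : ℕ) (p r : Polynomial ℝ) :
    polyMult d l (p + r) = polyMult d l p + polyMult d l r :=
  Polynomial.sum_add_index _ _ _ (by simp) (by simp [add_mul])

lemma polyMult_C_mul (d l : ℕ) (a : ℝ) (p : Polynomial ℝ) :
    polyMult d l (Polynomial.C a * p) = a * polyMult d l p := by
  rw [← Polynomial.smul_eq_C_mul, polyMult, Polynomial.sum_smul_index _ _ _ (by simp), polyMult,
    Polynomial.sum_def, Polynomial.sum_def, Finset.mul_sum]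
  exact Finset.sum_congr rfl fun m _ => by ring

lemma polyMult_X_pow (d l m : ℕ) : polyMult d l (Polynomial.X ^ m) = monoMult d m l := by
  rw [polyMult, ← Polynomial.monomial_one_right_eq_X_pow, Polynomial.sum_monomial_index] <;> simp

lemma polyMult_X_mul {d : ℕ} (hd : 2 ≤ d) (l : ℕ) (p : Polynomial ℝ) :
    2 * ((l : ℝ) + 1 + ((d : ℝ) - 2) / 2) * polyMult d (l + 1) (Polynomial.X * p)
      = (l + 1) * polyMult d l p + (l + 1 + ((d : ℝ) - 2)) * polyMult d (l + 2) p := by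
  induction p using Polynomial.induction_on' with
  | add p r hp hr =>
    rw [mul_add Polynomial.X, polyMult_add, polyMult_add, polyMult_add]
    linear_combination hp + hr
  | monomial m a =>
    rw [← Polynomial.C_mul_X_pow_eq_monomial, mul_left_comm, ← pow_succ']
    simp only [polyMult_C_mul, polyMult_X_pow]
    linear_combination a * monoMult_rec hd m l

lemma polyMult_X_mul_zero {d : ℕ} (p : Polynomial ℝ) :
    polyMult d 0 (Polynomial.X * p) = polyMult d 1 p := by
  induction p using Polynomial.induction_on' with
  | add p r hp hr => rw [mul_add, polyMult_add, polyMult_add, hp, hr]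
  | monomial m a =>
    rw [← Polynomial.C_mul_X_pow_eq_monomial, mul_left_comm, ← pow_succ']
    simp only [polyMult_C_mul, polyMult_X_pow, monoMult_rec_zero]

lemma cdim_succ (e i : ℕ) : (i + 1) * cdim (e + 2) (i + 1) = (2 * i + 2 + e) * (i + e).choose i := by
  rw [cdim, if_neg (by omega), show i + 1 + (e + 2) - 2 = i + e + 1 by omega,
    show i + 1 + (e + 2) - 3 = i + e by omega, Nat.add_sub_cancel]
  have := Nat.add_one_mul_choose_eq (i + e) i
  linarith

lemma cdim_pos (e j : ℕ) : 0 < cdim (e + 2) j := by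
  rcases j with _ | i
  · simp [cdim]
  · have h := cdim_succ e i
    have : 0 < (i + e).choose i := Nat.choose_pos (by omega)
    by_contra h0
    rw [Nat.eq_zero_of_not_pos h0] at h
    have : 0 < (2 * i + 2 + e) * (i + e).choose i := by positivity
    omega

lemma cdim_rec (e i : ℕ) : cdim (e + 2) (i + 2) * ((i + 2) * (2 * (i + 1) + e))
    = cdim (e + 2) (i + 1) * ((2 * (i + 2) + e) * (i + 1 + e)) := by
  have h1 := cdim_succ e i
  have h2 := cdim_succ e (i + 1)
  have h3 : (i + e + 1) * (i + e).choose i = (i + 1 + e).choose (i + 1) * (i + 1) := by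
    rw [show i + 1 + e = i + e + 1 by ring]
    exact Nat.add_one_mul_choose_eq (i + e) i
  have : (i + 1) * (cdim (e + 2) (i + 2) * ((i + 2) * (2 * (i + 1) + e)))
    = (i + 1) * (cdim (e + 2) (i + 1) * ((2 * (i + 2) + e) * (i + 1 + e))) := by
    zify at *
    linear_combination ((i : ℤ) + 1) * (2 * (i + 1) + e) * h2 - ((2 * ((i : ℤ) + 2) + e) * (i + 1 + e)) * h1
      - (2 * (i + 1) + 2 + (e : ℤ)) * (2 * (i + 1) + e) * h3
  exact Nat.eq_of_mul_eq_mul_left (by omega) this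

lemma polyMult_ultra {d : ℕ} (hd : 2 ≤ d) (j l : ℕ) :
    polyMult d l (ultra (((d : ℝ) - 2) / 2) j)
      = if l = j then sphereArea d / cdim d j else 0 := by
  obtain ⟨e, rfl⟩ : ∃ e, d = e + 2 := ⟨d - 2, by omega⟩
  have hb : (((e + 2 : ℕ) : ℝ) - 2) / 2 = (e : ℝ) / 2 := by push_cast; ring
  rw [hb]
  have hc1 : cdim (e + 2) 1 = e + 2 := by
    have := cdim_succ e 0
    simpa [add_comm] using this
  have hM0 : ∀ l, polyMult (e + 2) l 1 = if l = 0 then sphereArea (e + 2) else 0 := by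
    intro l
    rw [← pow_zero (Polynomial.X : Polynomial ℝ), polyMult_X_pow]
    rcases l with _ | l
    · have := monoMult_add (e + 2) 0 0
      simp only [mul_zero, add_zero] at this
      rw [this, sphereArea]
      simp
    · rw [monoMult_eq_zero (by omega), if_neg (by omega)]
  have hM1 : ∀ l, polyMult (e + 2) l Polynomial.X
      = if l = 1 then sphereArea (e + 2) / cdim (e + 2) 1 else 0 := by
    intro l
    rw [← pow_one (Polynomial.X : Polynomial ℝ), polyMult_X_pow]
    split_ifs with h
    · subst h
      have := monoMult_add (e + 2) 1 0
      simp only [mul_zero, add_zero] at this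
      have hG : Real.Gamma ((e + 2 : ℝ) / 2) ≠ 0 := (Real.Gamma_pos_of_pos (by positivity)).ne'
      rw [this, sphereArea, hc1]
      push_cast
      rw [show (1 : ℝ) + 0 + (e + 2) / 2 = (e + 2) / 2 + 1 by ring, Real.Gamma_add_one (by positivity)]
      simp
      field_simp
    · refine monoMult_eq_zero ?_
      rintro ⟨h1, i, h2⟩
      omega
  induction j using Nat.twoStepInduction generalizing l with
  | zero => simpa [ultra, cdim] using hM0 l
  | one => simpa [ultra] using hM1 l
  | more j h0 h1 =>
    have hpos : (0 : ℝ) < j + 1 + 2 * ((e : ℝ) / 2) := by positivity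
    have hu : polyMult (e + 2) l (ultra ((e : ℝ) / 2) (j + 2))
        = 2 * (j + 1 + (e : ℝ) / 2) / (j + 1 + 2 * ((e : ℝ) / 2)) *
            polyMult (e + 2) l (Polynomial.X * ultra ((e : ℝ) / 2) (j + 1))
          - (j + 1) / (j + 1 + 2 * ((e : ℝ) / 2)) * polyMult (e + 2) l (ultra ((e : ℝ) / 2) j) := by
      rw [ultra, sub_eq_add_neg, ← neg_mul, ← Polynomial.C_neg, polyMult_add, polyMult_C_mul,
        polyMult_C_mul]
      ring
    rw [hu, h0]
    have hcr : (cdim (e + 2) (j + 2) : ℝ) * ((j + 2) * (2 * (j + 1) + e))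
      = cdim (e + 2) (j + 1) * ((2 * (j + 2) + e) * (j + 1 + e)) := by
      exact_mod_cast cdim_rec e j
    have hp0 : (0 : ℝ) < cdim (e + 2) j := by exact_mod_cast cdim_pos e j
    have hp1 : (0 : ℝ) < cdim (e + 2) (j + 1) := by exact_mod_cast cdim_pos e (j + 1)
    have hp2 : (0 : ℝ) < cdim (e + 2) (j + 2) := by exact_mod_cast cdim_pos e (j + 2)
    rcases l with _ | l
    · rw [polyMult_X_mul_zero, h1]
      rcases j with _ | j
      · have hc0 : cdim (e + 2) 0 = 1 := by simp [cdim]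
        rw [if_pos rfl, if_pos rfl, if_neg (by omega), hc0, zero_add, hc1]
        push_cast
        field_simp
        ring
      · simp
    · have hx := polyMult_X_mul (d := e + 2) (by omega) l (ultra ((e : ℝ) / 2) (j + 1))
      rw [h1, h1] at hx
      push_cast at hx
      have hq : (0 : ℝ) < 2 * (l + 1 + (e + 2 - 2) / 2) := by
        have : (0 : ℝ) ≤ (e + 2 - 2) / 2 := by ring_nf; positivity
        positivity
      have hx' := (eq_div_iff hq.ne').2 ((mul_comm _ _).trans hx)
      rw [hx']
      by_cases c1 : l = j + 1
      · subst c1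
        rw [if_pos rfl, if_neg (by omega), if_neg (by omega), if_pos rfl,
          eq_div_of_mul_eq (by positivity) hcr]
        push_cast
        rw [show (e : ℝ) + 2 - 2 = e by ring]
        field_simp
        ring
      · by_cases c2 : l + 1 = j
        · subst c2
          rw [if_neg (by omega), if_pos rfl, if_pos rfl, if_neg (by omega)]
          have hcr' : (cdim (e + 2) (l + 2) : ℝ) * ((l + 2) * (2 * (l + 1) + e))
            = cdim (e + 2) (l + 1) * ((2 * (l + 2) + e) * (l + 1 + e)) := by
            exact_mod_cast cdim_rec e l
          have hp2 : (0 : ℝ) < cdim (e + 2) (l + 2) := by exact_mod_cast cdim_pos e (l + 2)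
          push_cast
          rw [show (e : ℝ) + 2 - 2 = e by ring]
          have : cdim (e + 2) (l + 1 + 1) = cdim (e + 2) (l + 2) := rfl
          rw [this, eq_div_of_mul_eq (by positivity) hcr']
          field_simp
          ring
        · rw [if_neg (by omega), if_neg (by omega), if_neg (by omega), if_neg (by omega)]
          simp

lemma cdim_le (d j : ℕ) : cdim d j ≤ 2 * 2 ^ (j + d) := by
  rw [cdim]
  have hp : 1 ≤ 2 ^ (j + d) := Nat.one_le_two_pow
  split_ifs with h
  · omega
  · have h1 : (j + d - 2).choose j ≤ 2 ^ (j + d) :=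
      (Nat.choose_le_two_pow _ _).trans (Nat.pow_le_pow_right (by omega) (by omega))
    have h2 : (j + d - 3).choose (j - 1) ≤ 2 ^ (j + d) :=
      (Nat.choose_le_two_pow _ _).trans (Nat.pow_le_pow_right (by omega) (by omega))
    omega

open MvPolynomial in
/-- The Laplacian on polynomials. -/
def lap (d : ℕ) : MvPolynomial (Fin d) ℂ →ₗ[ℂ] MvPolynomial (Fin d) ℂ :=
  ∑ i : Fin d, (pderiv i).toLinearMap ∘ₗ (pderiv i).toLinearMap

open MvPolynomial in
lemma lap_apply {d : ℕ} (p : MvPolynomial (Fin d) ℂ) :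
    lap d p = ∑ i, pderiv i (pderiv i p) := by
  simp [lap]

open MvPolynomial in
/-- The polynomial `|x|²`. -/
def rsq (d : ℕ) : MvPolynomial (Fin d) ℂ := ∑ i, X i ^ 2

open MvPolynomial in
lemma rsq_isHomogeneous (d : ℕ) : (rsq d).IsHomogeneous 2 :=
  IsHomogeneous.sum _ _ _ fun i _ => by simpa using (isHomogeneous_X ℂ i).pow 2

open MvPolynomial in
lemma pderiv_rsq {d : ℕ} (i : Fin d) : pderiv i (rsq d) = 2 * X i := by
  rw [rsq, map_sum, Finset.sum_eq_single i]
  · simp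
  · intro j _ hj
    simp [pderiv_X_of_ne hj]
  · simp

open MvPolynomial in
lemma lap_rsq_mul {d m : ℕ} {s : MvPolynomial (Fin d) ℂ} (hs : s.IsHomogeneous m) :
    lap d (rsq d * s) = C (2 * d + 4 * m : ℂ) * s + rsq d * lap d s := by
  have h : ∀ i : Fin d, pderiv i (pderiv i (rsq d * s))
      = 2 * s + 4 * (X i * pderiv i s) + rsq d * pderiv i (pderiv i s) := by
    intro i
    have h2 : pderiv i (2 : MvPolynomial (Fin d) ℂ) = 0 := by
      rw [show (2 : MvPolynomial (Fin d) ℂ) = C 2 from (map_ofNat C 2).symm]; exact pderiv_C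
    simp only [pderiv_mul, pderiv_rsq, map_add, pderiv_X_self, h2]
    ring
  simp only [lap_apply, h, Finset.sum_add_distrib, ← Finset.mul_sum, hs.sum_X_mul_pderiv]
  simp [show (C 2 : MvPolynomial (Fin d) ℂ) = 2 from map_ofNat C 2,
    show (C 4 : MvPolynomial (Fin d) ℂ) = 4 from map_ofNat C 4]
  ring

open MvPolynomial in
lemma pderiv_eq_zero_of_isHomogeneous_zero {d : ℕ} {f : MvPolynomial (Fin d) ℂ}
    (hf : f.IsHomogeneous 0) (i : Fin d) : pderiv i f = 0 := by
  have h : f = _ := totalDegree_eq_zero_iff_eq_C.1 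
    ((totalDegree_zero_iff_isHomogeneous _).2 hf)
  rw [h]
  simp

open MvPolynomial in
lemma lap_eq_zero_of_lt {d m : ℕ} (hm : m < 2) {f : MvPolynomial (Fin d) ℂ}
    (hf : f.IsHomogeneous m) : lap d f = 0 := by
  rw [lap_apply]
  refine Finset.sum_eq_zero fun i _ => pderiv_eq_zero_of_isHomogeneous_zero ?_ i
  have := hf.pderiv (i := i)
  rwa [show m - 1 = 0 by omega] at this

open MvPolynomial in
lemma lap_isHomogeneous {d m : ℕ} {f : MvPolynomial (Fin d) ℂ}
    (hf : f.IsHomogeneous (m + 2)) : (lap d f).IsHomogeneous m := by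
  rw [lap_apply]
  exact IsHomogeneous.sum _ _ _ fun i _ => hf.pderiv.pderiv

open MvPolynomial in
lemma exists_add_rsq_mul_lap {d : ℕ} (m : ℕ) : ∀ (c : ℝ), 0 < c → ∀ f : MvPolynomial (Fin d) ℂ,
    f.IsHomogeneous m → ∃ r : MvPolynomial (Fin d) ℂ, r.IsHomogeneous m ∧
      C (c : ℂ) * r + rsq d * lap d r = f := by
  have small : ∀ m < 2, ∀ (c : ℝ), 0 < c → ∀ f : MvPolynomial (Fin d) ℂ,
    f.IsHomogeneous m → ∃ r : MvPolynomial (Fin d) ℂ, r.IsHomogeneous m ∧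
      C (c : ℂ) * r + rsq d * lap d r = f := by
    intro m hm c hc f hf
    have hr : (C (c⁻¹ : ℂ) * f).IsHomogeneous m := by
      simpa using (isHomogeneous_C (Fin d) (c⁻¹ : ℂ)).mul hf
    refine ⟨_, hr, ?_⟩
    have : (c : ℂ) ≠ 0 := by exact_mod_cast hc.ne'
    rw [lap_eq_zero_of_lt hm hr, ← mul_assoc, ← C_mul, mul_inv_cancel₀ this]
    simp
  induction m using Nat.twoStepInduction with
  | zero => exact small 0 (by omega)
  | one => exact small 1 (by omega)
  | more m ih _ =>
    intro c hc f hf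
    obtain ⟨s, hs, hsf⟩ := ih (c + (2 * d + 4 * m)) (by positivity) _ (lap_isHomogeneous hf)
    have hc0 : (c : ℂ) ≠ 0 := by exact_mod_cast hc.ne'
    have hrs : (rsq d * s).IsHomogeneous (m + 2) := by
      simpa [add_comm] using (rsq_isHomogeneous d).mul hs
    refine ⟨C (c⁻¹ : ℂ) * (f - rsq d * s), by
      simpa using (isHomogeneous_C (Fin d) (c⁻¹ : ℂ)).mul (hf.sub hrs), ?_⟩
    have hl : lap d (C (c⁻¹ : ℂ) * (f - rsq d * s)) = s := by
      rw [← smul_eq_C_mul, map_smul, map_sub, lap_rsq_mul hs, ← hsf]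
      push_cast
      rw [C_add, show (C (c : ℂ) + C (2 * (d : ℂ) + 4 * m)) * s + rsq d * lap d s -
        (C (2 * (d : ℂ) + 4 * m) * s + rsq d * lap d s) = C (c : ℂ) * s by ring,
        ← smul_eq_C_mul, smul_smul, inv_mul_cancel₀ hc0, one_smul]
    rw [hl, ← mul_assoc, ← C_mul, mul_inv_cancel₀ hc0]
    simp

open MvPolynomial in
/-- On the unit sphere, `p` agrees with a sum of homogeneous harmonic polynomials of degrees at
most `n`. -/
def HasHarmonicDecomp (d n : ℕ) (p : MvPolynomial (Fin d) ℂ) : Prop :=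
  ∃ Y : ℕ → MvPolynomial (Fin d) ℂ, (∀ j, (Y j).IsHomogeneous j ∧ lap d (Y j) = 0) ∧
    ∀ x : Fin d → ℂ, ∑ i, x i ^ 2 = 1 → eval x p = ∑ j ∈ Finset.range (n + 1), eval x (Y j)

open MvPolynomial in
lemma HasHarmonicDecomp.add {d n : ℕ} {p r : MvPolynomial (Fin d) ℂ}
    (hp : HasHarmonicDecomp d n p) (hr : HasHarmonicDecomp d n r) :
    HasHarmonicDecomp d n (p + r) := by
  obtain ⟨Y, hY, hYp⟩ := hp
  obtain ⟨Z, hZ, hZr⟩ := hr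
  refine ⟨fun j => Y j + Z j, fun j => ⟨(hY j).1.add (hZ j).1, ?_⟩, fun x hx => ?_⟩
  · rw [map_add, (hY j).2, (hZ j).2, add_zero]
  · simp only [map_add, Finset.sum_add_distrib, hYp x hx, hZr x hx]

open MvPolynomial in
lemma HasHarmonicDecomp.of_harmonic {d n m : ℕ} (hmn : m ≤ n) {p : MvPolynomial (Fin d) ℂ}
    (hp : p.IsHomogeneous m) (hl : lap d p = 0) : HasHarmonicDecomp d n p := by
  refine ⟨fun j => if j = m then p else 0, fun j => ?_, fun x _ => ?_⟩
  · dsimp only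
    split_ifs with h
    · subst h; exact ⟨hp, hl⟩
    · exact ⟨isHomogeneous_zero _ _ _, map_zero _⟩
  · rw [Finset.sum_eq_single m]
    · simp
    · intro j _ hj; simp [hj]
    · intro h; exact absurd (Finset.mem_range.2 (by omega)) h

open MvPolynomial in
lemma HasHarmonicDecomp.of_isHomogeneous {d : ℕ} (hd : 0 < d) {n : ℕ} (m : ℕ) (hmn : m ≤ n)
    {p : MvPolynomial (Fin d) ℂ} (hp : p.IsHomogeneous m) : HasHarmonicDecomp d n p := by
  induction m using Nat.twoStepInduction generalizing p with
  | zero => exact .of_harmonic hmn hp (lap_eq_zero_of_lt (by omega) hp)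
  | one => exact .of_harmonic hmn hp (lap_eq_zero_of_lt (by omega) hp)
  | more m ih _ =>
    obtain ⟨r, hr, hrp⟩ := exists_add_rsq_mul_lap m (2 * d + 4 * m) (by positivity) _
      (lap_isHomogeneous hp)
    have hrs : (rsq d * r).IsHomogeneous (m + 2) := by
      simpa [add_comm] using (rsq_isHomogeneous d).mul hr
    have h1 : HasHarmonicDecomp d n (p - rsq d * r) := by
      refine .of_harmonic hmn (hp.sub hrs) ?_
      rw [map_sub, lap_rsq_mul hr, ← hrp]
      push_cast
      ring
    have h2 : HasHarmonicDecomp d n (rsq d * r) := by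
      obtain ⟨Y, hY, hYr⟩ := ih (by omega) hr
      refine ⟨Y, hY, fun x hx => ?_⟩
      rw [map_mul, rsq, map_sum, ← hYr x hx]
      simp [hx]
    simpa using h1.add h2

open MvPolynomial in
lemma HasHarmonicDecomp.of_totalDegree_le {d : ℕ} (hd : 0 < d) {n : ℕ}
    {p : MvPolynomial (Fin d) ℂ} (hp : p.totalDegree ≤ n) : HasHarmonicDecomp d n p := by
  rw [← sum_homogeneousComponent p]
  refine Finset.sum_induction _ (HasHarmonicDecomp d n) (fun _ _ => .add) ?_ fun i hi => ?_
  · exact .of_isHomogeneous hd n le_rfl (isHomogeneous_zero _ _ _)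
  · exact .of_isHomogeneous hd i ((Nat.lt_succ_iff.1 (Finset.mem_range.1 hi)).trans hp)
      (homogeneousComponent_isHomogeneous i p)

/-- The value of a complex polynomial at a real point. -/
def ev {d : ℕ} (p : MvPolynomial (Fin d) ℂ) (x : Ed d) : ℂ :=
  MvPolynomial.eval (fun i => ((x i : ℝ) : ℂ)) p

@[simp] lemma ev_add {d : ℕ} (p r : MvPolynomial (Fin d) ℂ) (x : Ed d) :
    ev (p + r) x = ev p x + ev r x := map_add _ _ _
@[simp] lemma ev_mul {d : ℕ} (p r : MvPolynomial (Fin d) ℂ) (x : Ed d) :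
    ev (p * r) x = ev p x * ev r x := map_mul _ _ _
@[simp] lemma ev_pow {d : ℕ} (p : MvPolynomial (Fin d) ℂ) (n : ℕ) (x : Ed d) :
    ev (p ^ n) x = ev p x ^ n := map_pow _ _ _
@[simp] lemma ev_zero {d : ℕ} (x : Ed d) : ev (0 : MvPolynomial (Fin d) ℂ) x = 0 := map_zero _
@[simp] lemma ev_one {d : ℕ} (x : Ed d) : ev (1 : MvPolynomial (Fin d) ℂ) x = 1 := map_one _
@[simp] lemma ev_C {d : ℕ} (a : ℂ) (x : Ed d) :
    ev (MvPolynomial.C a : MvPolynomial (Fin d) ℂ) x = a := MvPolynomial.eval_C _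
@[simp] lemma ev_X {d : ℕ} (i : Fin d) (x : Ed d) :
    ev (MvPolynomial.X i) x = ((x i : ℝ) : ℂ) := MvPolynomial.eval_X _
lemma ev_sum {d : ℕ} {ι : Type*} (s : Finset ι) (p : ι → MvPolynomial (Fin d) ℂ) (x : Ed d) :
    ev (∑ i ∈ s, p i) x = ∑ i ∈ s, ev (p i) x := map_sum _ _ _

lemma continuous_ev {d : ℕ} (p : MvPolynomial (Fin d) ℂ) : Continuous (ev p) :=
  (MvPolynomial.continuous_eval p).comp (by fun_prop)

lemma hasFDerivAt_ev {d : ℕ} (p : MvPolynomial (Fin d) ℂ) (x : Ed d) :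
    HasFDerivAt (ev p) (∑ i, (EuclideanSpace.proj i : Ed d →L[ℝ] ℝ).smulRight
      (ev (MvPolynomial.pderiv i p) x)) x := by
  induction p using MvPolynomial.induction_on with
  | C a =>
    have h : ev (MvPolynomial.C a : MvPolynomial (Fin d) ℂ) = fun _ => a := by ext; simp
    rw [h]
    exact (hasFDerivAt_const a x).congr_fderiv (by simp)
  | add p r hp hr =>
    have h : ev (p + r) = fun x => ev p x + ev r x := by ext; simp
    rw [h]
    refine (hp.add hr).congr_fderiv ?_
    ext v
    simp [Finset.sum_add_distrib]
  | mul_X p j hp =>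
    have h : ev (p * MvPolynomial.X j) = fun x => ev p x * ((x j : ℝ) : ℂ) := by ext; simp
    rw [h]
    have hX : HasFDerivAt (fun x : Ed d => ((x j : ℝ) : ℂ))
        (Complex.ofRealCLM.comp (EuclideanSpace.proj j : Ed d →L[ℝ] ℝ)) x :=
      (Complex.ofRealCLM.comp (EuclideanSpace.proj j : Ed d →L[ℝ] ℝ)).hasFDerivAt
    refine (hp.mul hX).congr_fderiv ?_
    ext v
    have e : ∀ i, ev ((MvPolynomial.pderiv i) (MvPolynomial.X j) : MvPolynomial (Fin d) ℂ) x
        = if i = j then 1 else 0 := by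
      intro i
      split_ifs with hij
      · subst hij; simp
      · rw [MvPolynomial.pderiv_X_of_ne (Ne.symm hij), ev_zero]
    simp only [MvPolynomial.pderiv_mul, ev_add, ev_mul, e, ev_X]
    simp [Finset.sum_add_distrib, Finset.mul_sum]
    rw [add_comm]
    congr 1
    · exact Finset.sum_congr rfl fun i _ => by ring
    · ring

lemma fderiv_ev_single {d : ℕ} (p : MvPolynomial (Fin d) ℂ) (x : Ed d) (i : Fin d) :
    fderiv ℝ (ev p) x (EuclideanSpace.single i 1) = ev (MvPolynomial.pderiv i p) x := by
  rw [(hasFDerivAt_ev p x).fderiv]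
  simp

lemma exists_norm_ev_le {d : ℕ} (p : MvPolynomial (Fin d) ℂ) :
    ∃ C : ℝ, ∃ N : ℕ, 0 ≤ C ∧ ∀ x : Ed d, ‖ev p x‖ ≤ C * (1 + ‖x‖) ^ N := by
  induction p using MvPolynomial.induction_on with
  | C a => exact ⟨‖a‖, 0, norm_nonneg _, fun x => by simp⟩
  | add p r hp hr =>
    obtain ⟨C, N, hC, h⟩ := hp
    obtain ⟨C', N', hC', h'⟩ := hr
    refine ⟨C + C', N + N', by positivity, fun x => ?_⟩
    have h1 : 1 ≤ 1 + ‖x‖ := by linarith [norm_nonneg x]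
    rw [ev_add, add_mul]
    refine (norm_add_le _ _).trans (add_le_add ((h x).trans ?_) ((h' x).trans ?_))
    · gcongr; omega
    · gcongr; omega
  | mul_X p j hp =>
    obtain ⟨C, N, hC, h⟩ := hp
    refine ⟨C, N + 1, hC, fun x => ?_⟩
    rw [ev_mul, norm_mul, pow_succ, ← mul_assoc, ev_X, Complex.norm_real]
    have := PiLp.norm_apply_le x j
    have h0 := norm_nonneg x
    exact mul_le_mul (h x) (by linarith) (norm_nonneg _) (by positivity)

lemma integrable_exp_neg_mul_sq_norm {d : ℕ} {b : ℝ} (hb : 0 < b) :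
    Integrable (fun z : Ed d => rexp (-b * ‖z‖ ^ 2)) := by
  have h := GaussianFourier.integrable_cexp_neg_mul_sq_norm_add (V := Ed d)
    (b := (b : ℂ)) (by simpa using hb) 0 0
  refine h.norm.congr (ae_of_all _ fun z => ?_)
  simp [Complex.norm_exp, ← Complex.ofReal_pow]

lemma integrable_gaussian_mul_ev {d : ℕ} (p : MvPolynomial (Fin d) ℂ) :
    Integrable (fun z : Ed d => ((rexp (-‖z‖ ^ 2) : ℝ) : ℂ) * ev p z) := by
  obtain ⟨C, N, hC, h⟩ := exists_norm_ev_le p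
  refine ((integrable_exp_neg_mul_sq_norm (d := d) (b := 1 / 2) (by norm_num)).const_mul
    (C * (N.factorial * rexp (3 / 2)))).mono' ?_ (ae_of_all _ fun z => ?_)
  · exact (Continuous.mul (by fun_prop) (continuous_ev p)).aestronglyMeasurable
  · rw [norm_mul, Complex.norm_real, norm_of_nonneg (exp_pos _).le]
    have h1 : (1 + ‖z‖) ^ N ≤ N.factorial * rexp (1 + ‖z‖) := by
      have := Real.pow_div_factorial_le_exp (1 + ‖z‖) (by positivity) N
      rwa [div_le_iff₀ (by positivity), mul_comm] at this
    calc _ ≤ rexp (-‖z‖ ^ 2) * (C * (N.factorial * rexp (1 + ‖z‖))) := by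
          gcongr
          exact (h z).trans (by gcongr)
      _ = C * N.factorial * rexp (-‖z‖ ^ 2 + (1 + ‖z‖)) := by rw [exp_add (-‖z‖ ^ 2)]; ring
      _ ≤ C * N.factorial * rexp (3 / 2 + -(1 / 2) * ‖z‖ ^ 2) := by
          refine mul_le_mul_of_nonneg_left (exp_le_exp.2 ?_) (by positivity)
          nlinarith [sq_nonneg (‖z‖ - 1)]
      _ = _ := by rw [exp_add]; ring

/-- The Gaussian integral of a polynomial. -/
def gaussInt {d : ℕ} (p : MvPolynomial (Fin d) ℂ) : ℂ :=
  ∫ z : Ed d, ((rexp (-‖z‖ ^ 2) : ℝ) : ℂ) * ev p z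

lemma gaussInt_add {d : ℕ} (p r : MvPolynomial (Fin d) ℂ) :
    gaussInt (p + r) = gaussInt p + gaussInt r := by
  rw [gaussInt, gaussInt, gaussInt,
    ← integral_add (integrable_gaussian_mul_ev p) (integrable_gaussian_mul_ev r)]
  simp [mul_add]

lemma gaussInt_C_mul {d : ℕ} (a : ℂ) (p : MvPolynomial (Fin d) ℂ) :
    gaussInt (MvPolynomial.C a * p) = a * gaussInt p := by
  rw [gaussInt, gaussInt, ← integral_const_mul]
  congr 1
  ext z
  simp
  ring

lemma gaussInt_zero {d : ℕ} : gaussInt (0 : MvPolynomial (Fin d) ℂ) = 0 := by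
  simp [gaussInt]

lemma gaussInt_sum {d : ℕ} {ι : Type*} (s : Finset ι) (p : ι → MvPolynomial (Fin d) ℂ) :
    gaussInt (∑ i ∈ s, p i) = ∑ i ∈ s, gaussInt (p i) := by
  classical
  induction s using Finset.induction_on with
  | empty => simp [gaussInt_zero]
  | insert a s ha ih => rw [Finset.sum_insert ha, Finset.sum_insert ha, gaussInt_add, ih]

lemma gaussInt_one {d : ℕ} : gaussInt (1 : MvPolynomial (Fin d) ℂ) = (π ^ ((d : ℝ) / 2) : ℝ) := by
  have := GaussianFourier.integral_rexp_neg_mul_sq_norm (V := Ed d) (b := 1) one_pos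
  simp only [finrank_euclideanSpace, Fintype.card_fin, div_one] at this
  rw [← this, gaussInt, ← integral_complex_ofReal]
  simp

lemma fderiv_gaussian {d : ℕ} (z : Ed d) (i : Fin d) :
    fderiv ℝ (fun z : Ed d => ((rexp (-‖z‖ ^ 2) : ℝ) : ℂ)) z (EuclideanSpace.single i 1)
      = ((rexp (-‖z‖ ^ 2) : ℝ) : ℂ) * (-2 * (z i : ℂ)) := by
  have h1 : HasFDerivAt (fun z : Ed d => ‖z‖ ^ 2) (2 • innerSL ℝ z) z :=
    (hasStrictFDerivAt_norm_sq z).hasFDerivAt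
  have h2 := Complex.ofRealCLM.hasFDerivAt.comp z (h1.neg.exp)
  change fderiv ℝ (Complex.ofRealCLM ∘ fun x : Ed d => rexp ((-fun z : Ed d => ‖z‖ ^ 2) x)) z _ = _
  rw [HasFDerivAt.fderiv h2]
  simp [EuclideanSpace.inner_single_right]

lemma gaussInt_X_mul {d : ℕ} (i : Fin d) (p : MvPolynomial (Fin d) ℂ) :
    gaussInt (MvPolynomial.X i * p) = 1 / 2 * gaussInt (MvPolynomial.pderiv i p) := by
  have hX := integrable_gaussian_mul_ev (MvPolynomial.X i * p)
  have e : (fun z : Ed d => fderiv ℝ (fun z : Ed d => ((rexp (-‖z‖ ^ 2) : ℝ) : ℂ)) z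
      (EuclideanSpace.single i 1) * ev p z)
      = fun z => -2 * (((rexp (-‖z‖ ^ 2) : ℝ) : ℂ) * ev (MvPolynomial.X i * p) z) := by
    ext z
    rw [fderiv_gaussian, ev_mul, ev_X]
    ring
  have h := integral_mul_fderiv_eq_neg_fderiv_mul_of_integrable (μ := (volume : Measure (Ed d)))
    (f := fun z : Ed d => ((rexp (-‖z‖ ^ 2) : ℝ) : ℂ)) (g := ev p)
    (v := EuclideanSpace.single i 1) (by rw [e]; exact hX.const_mul _)
    (by simpa only [fderiv_ev_single] using integrable_gaussian_mul_ev _)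
    (integrable_gaussian_mul_ev p)
    (fun z _ => by
      have h1 : HasFDerivAt (fun z : Ed d => ‖z‖ ^ 2) (2 • innerSL ℝ z) z :=
        (hasStrictFDerivAt_norm_sq z).hasFDerivAt
      exact (Complex.ofRealCLM.hasFDerivAt.comp z (h1.neg.exp)).differentiableAt)
    (fun z _ => (hasFDerivAt_ev p z).differentiableAt)
  rw [e, integral_const_mul] at h
  simp only [fderiv_ev_single] at h
  rw [gaussInt, gaussInt, h]
  ring

/-- The linear form `⟨x, ·⟩` as a polynomial. -/
def linForm {d : ℕ} (x : Ed d) : MvPolynomial (Fin d) ℂ :=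
  ∑ i, MvPolynomial.C (x i : ℂ) * MvPolynomial.X i

lemma ev_linForm {d : ℕ} (x z : Ed d) : ev (linForm x) z = ((⟪x, z⟫ : ℝ) : ℂ) := by
  rw [linForm, ev_sum, PiLp.inner_apply]
  push_cast
  exact Finset.sum_congr rfl fun i _ => by simp [mul_comm]

open MvPolynomial in
/-- Directional derivative of a polynomial. -/
def dirDeriv {d : ℕ} (x : Ed d) (p : MvPolynomial (Fin d) ℂ) : MvPolynomial (Fin d) ℂ :=
  ∑ i, C (x i : ℂ) * pderiv i p

open MvPolynomial in
lemma pderiv_linForm {d : ℕ} (x : Ed d) (i : Fin d) : pderiv i (linForm x) = C (x i : ℂ) := by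
  rw [linForm, map_sum, Finset.sum_eq_single i]
  · simp
  · intro j _ hj
    simp [pderiv_X_of_ne hj]
  · simp

open MvPolynomial in
lemma gaussInt_linForm_pow {d : ℕ} (x : Ed d) (m : ℕ) (Y : MvPolynomial (Fin d) ℂ) :
    gaussInt (linForm x ^ (m + 1) * Y) = m / 2 * (‖x‖ ^ 2 : ℝ) * gaussInt (linForm x ^ (m - 1) * Y)
      + 1 / 2 * gaussInt (linForm x ^ m * dirDeriv x Y) := by
  have h1 : linForm x ^ (m + 1) * Y = ∑ i, C (x i : ℂ) * (X i * (linForm x ^ m * Y)) := by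
    rw [pow_succ, mul_right_comm, mul_comm]
    nth_rewrite 1 [linForm]
    rw [Finset.sum_mul]
    exact Finset.sum_congr rfl fun i _ => by ring
  have h2 : linForm x ^ m * dirDeriv x Y = ∑ i, C (x i : ℂ) * (linForm x ^ m * pderiv i Y) := by
    rw [dirDeriv, Finset.mul_sum]
    exact Finset.sum_congr rfl fun i _ => by ring
  have h3 : ((‖x‖ ^ 2 : ℝ) : ℂ) = ∑ i, (x i : ℂ) ^ 2 := by
    rw [EuclideanSpace.norm_sq_eq]; simp [← Complex.ofReal_pow]
  have h4 : ∀ i, pderiv i (linForm x ^ m * Y)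
      = C ((m : ℂ) * x i) * (linForm x ^ (m - 1) * Y) + linForm x ^ m * pderiv i Y := by
    intro i
    rw [pderiv_mul, pderiv_pow, pderiv_linForm, C_mul, map_natCast]
    ring
  rw [h1, h2, gaussInt_sum, gaussInt_sum, h3, Finset.mul_sum, Finset.mul_sum, Finset.sum_mul,
    ← Finset.sum_add_distrib]
  refine Finset.sum_congr rfl fun i _ => ?_
  rw [gaussInt_C_mul, gaussInt_C_mul, gaussInt_X_mul, h4, gaussInt_add, gaussInt_C_mul]
  ring

open MvPolynomial in
lemma dirDeriv_isHomogeneous {d j : ℕ} (x : Ed d) {Y : MvPolynomial (Fin d) ℂ}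
    (hY : Y.IsHomogeneous j) : (dirDeriv x Y).IsHomogeneous (j - 1) :=
  IsHomogeneous.sum _ _ _ fun i _ => by
    simpa using (isHomogeneous_C (Fin d) (x i : ℂ)).mul (hY.pderiv (i := i))

open MvPolynomial in
lemma pderiv_comm {d : ℕ} (i j : Fin d) (p : MvPolynomial (Fin d) ℂ) :
    pderiv i (pderiv j p) = pderiv j (pderiv i p) := by
  have hX : ∀ i j k : Fin d, pderiv i (pderiv j (X k : MvPolynomial (Fin d) ℂ)) = 0 := by
    intro i j k
    rcases eq_or_ne k j with rfl | hk
    · rw [pderiv_X_self, pderiv_one]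
    · rw [pderiv_X_of_ne hk, map_zero]
  have h : ⁅pderiv (R := ℂ) i, pderiv j⁆ = 0 := derivation_ext fun k => by
    rw [Derivation.commutator_apply, hX, hX, sub_zero, Derivation.zero_apply]
  have := congrArg (fun D => D p) h
  rwa [Derivation.commutator_apply, Derivation.zero_apply, sub_eq_zero] at this

open MvPolynomial in
lemma lap_dirDeriv {d : ℕ} (x : Ed d) (Y : MvPolynomial (Fin d) ℂ) :
    lap d (dirDeriv x Y) = dirDeriv x (lap d Y) := by
  simp only [dirDeriv, map_sum, ← smul_eq_C_mul, map_smul]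
  refine Finset.sum_congr rfl fun i _ => ?_
  congr 1
  simp only [lap_apply, map_sum]
  refine Finset.sum_congr rfl fun k _ => ?_
  rw [pderiv_comm k i, pderiv_comm k i]

open MvPolynomial in
lemma ev_dirDeriv_self {d j : ℕ} (x : Ed d) {Y : MvPolynomial (Fin d) ℂ}
    (hY : Y.IsHomogeneous j) : ev (dirDeriv x Y) x = j * ev Y x := by
  have h := congrArg (fun p => ev p x) hY.sum_X_mul_pderiv
  simp only [ev_sum, ev_mul, ev_X, nsmul_eq_mul] at h
  rw [dirDeriv, ev_sum]
  simp only [ev_mul, ev_C]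
  rw [h]
  congr 1
  exact map_natCast _ _

open MvPolynomial in
lemma gaussInt_harmonic {d j : ℕ} (hj : j ≠ 0) {Y : MvPolynomial (Fin d) ℂ}
    (hY : Y.IsHomogeneous j) (hl : lap d Y = 0) : gaussInt Y = 0 := by
  have h := congrArg gaussInt hY.sum_X_mul_pderiv
  rw [gaussInt_sum, nsmul_eq_mul, ← map_natCast (C : ℂ →+* MvPolynomial (Fin d) ℂ),
    gaussInt_C_mul] at h
  simp only [gaussInt_X_mul] at h
  rw [← Finset.mul_sum, ← gaussInt_sum, ← lap_apply, hl, gaussInt_zero, mul_zero] at h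
  have : (j : ℂ) ≠ 0 := by exact_mod_cast hj
  simpa [this] using h.symm

/-- The multiplier in the Gaussian integral of `⟨x, z⟩ ^ m` against a harmonic polynomial of
degree `j`. -/
def gaussMult (d m j : ℕ) : ℝ :=
  if j ≤ m ∧ Even (m - j) then
    m.factorial * π ^ ((d : ℝ) / 2) * ((2 : ℝ) ^ j)⁻¹ * ((4 : ℝ) ^ ((m - j) / 2))⁻¹ /
      ((m - j) / 2).factorial else 0

lemma gaussMult_add (d j i : ℕ) : gaussMult d (j + 2 * i) j =
    (j + 2 * i).factorial * π ^ ((d : ℝ) / 2) * ((2 : ℝ) ^ j)⁻¹ * ((4 : ℝ) ^ i)⁻¹ /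
      i.factorial := by
  rw [gaussMult, if_pos ⟨by omega, by simp⟩, show (j + 2 * i - j) / 2 = i by omega]

lemma gaussMult_eq_zero {d m j : ℕ} (h : ¬ (j ≤ m ∧ Even (m - j))) : gaussMult d m j = 0 := by
  rw [gaussMult, if_neg h]

lemma gaussMult_step {d m j : ℕ} (hj : 0 < j) :
    gaussMult d (m + 1) j = m / 2 * gaussMult d (m - 1) j + j / 2 * gaussMult d m (j - 1) := by
  by_cases h : j ≤ m + 1 ∧ Even (m + 1 - j)
  · obtain ⟨hle, i, hi⟩ := h
    obtain ⟨n, rfl⟩ : ∃ n, j = n + 1 := ⟨j - 1, by omega⟩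
    obtain rfl : m = n + 2 * i := by omega
    rw [show n + 2 * i + 1 = n + 1 + 2 * i by ring, gaussMult_add, Nat.add_sub_cancel,
      gaussMult_add]
    rcases i with _ | i
    · rw [gaussMult_eq_zero (by omega)]
      simp [Nat.factorial_succ, pow_succ]
      ring
    · rw [show n + 2 * (i + 1) - 1 = n + 1 + 2 * i by omega, gaussMult_add,
        show n + 1 + 2 * (i + 1) = (n + 1 + 2 * i) + 1 + 1 by ring,
        show n + 2 * (i + 1) = (n + 1 + 2 * i) + 1 by ring]
      simp only [Nat.factorial_succ, pow_succ]
      push_cast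
      field_simp
      ring
  · rw [gaussMult_eq_zero h, gaussMult_eq_zero (m := m - 1), gaussMult_eq_zero (m := m)]
    · ring
    · rintro ⟨h1, i, hi⟩
      exact h ⟨by omega, i, by omega⟩
    · rintro ⟨h1, i, hi⟩
      exact h ⟨by omega, i + 1, by omega⟩

lemma gaussMult_step_zero (d m : ℕ) :
    gaussMult d (m + 1) 0 = m / 2 * gaussMult d (m - 1) 0 := by
  by_cases h : Even (m + 1)
  · obtain ⟨i, hi⟩ := h
    obtain ⟨n, rfl⟩ : ∃ n, i = n + 1 := ⟨i - 1, by omega⟩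
    obtain rfl : m = 2 * n + 1 := by omega
    have h1 := gaussMult_add d 0 (n + 1)
    have h2 := gaussMult_add d 0 n
    rw [zero_add] at h1 h2
    rw [show 2 * n + 1 + 1 = 2 * (n + 1) by ring, h1, Nat.add_sub_cancel, h2,
      show 2 * (n + 1) = 2 * n + 1 + 1 by ring]
    simp only [Nat.factorial_succ, pow_succ]
    push_cast
    field_simp
    ring
  · rw [gaussMult_eq_zero (by simpa using h)]
    rcases m with _ | m
    · simp
    · rw [gaussMult_eq_zero, mul_zero]
      rintro ⟨-, i, hi⟩
      exact h ⟨i + 1, by omega⟩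

open MvPolynomial in
lemma gaussInt_linForm_pow_mul {d : ℕ} (x : Ed d) (m : ℕ) : ∀ (j : ℕ) (Y : MvPolynomial (Fin d) ℂ),
    Y.IsHomogeneous j → lap d Y = 0 →
    gaussInt (linForm x ^ m * Y) = gaussMult d m j * (‖x‖ ^ 2 : ℝ) ^ ((m - j) / 2) * ev Y x := by
  induction m using Nat.strong_induction_on with
  | _ m ih =>
  intro j Y hY hl
  rcases m with _ | m
  · rw [pow_zero, one_mul]
    rcases Nat.eq_zero_or_pos j with rfl | hj
    · obtain ⟨a, rfl⟩ : ∃ a, Y = C a := ⟨_, totalDegree_eq_zero_iff_eq_C.1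
        (Nat.le_zero.1 hY.totalDegree_le)⟩
      have := gaussInt_C_mul a (1 : MvPolynomial (Fin d) ℂ)
      rw [mul_one, gaussInt_one] at this
      rw [this]
      simp [gaussMult]
      ring
    · rw [gaussInt_harmonic hj.ne' hY hl, gaussMult_eq_zero (by omega)]
      simp
  · rw [gaussInt_linForm_pow]
    have h1 := ih m (by omega) (j - 1) (dirDeriv x Y) (dirDeriv_isHomogeneous x hY)
      (by rw [lap_dirDeriv, hl]; simp [dirDeriv])
    rw [h1, ev_dirDeriv_self x hY]
    have h2 := ih (m - 1) (by omega) j Y hY hl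
    rw [h2]
    have h3 : (m : ℂ) / 2 * (‖x‖ ^ 2 : ℝ) * (gaussMult d (m - 1) j *
        ((‖x‖ ^ 2 : ℝ) : ℂ) ^ ((m - 1 - j) / 2)) = (m : ℂ) / 2 * (gaussMult d (m - 1) j *
        ((‖x‖ ^ 2 : ℝ) : ℂ) ^ ((m + 1 - j) / 2)) := by
      by_cases h : j ≤ m - 1 ∧ m ≠ 0
      · rw [show (m + 1 - j) / 2 = (m - 1 - j) / 2 + 1 by omega, pow_succ]
        ring
      · rcases Nat.eq_zero_or_pos m with rfl | hm
        · simp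
        · rw [gaussMult_eq_zero (by omega)]
          simp
    rcases Nat.eq_zero_or_pos j with rfl | hj
    · rw [gaussMult_step_zero]
      push_cast at h3 ⊢
      linear_combination ev Y x * h3
    · rw [gaussMult_step hj, show (m - (j - 1)) / 2 = (m + 1 - j) / 2 by omega]
      push_cast at h3 ⊢
      linear_combination ev Y x * h3

/-- Polar coordinates for a function that splits into a radial and an angular factor. -/
lemma integral_polar {d : ℕ} (hd : 0 < d) {G : Ed d → ℂ} {h : ℝ → ℂ} {f : Sph d → ℂ}
    (hG : ∀ r : ℝ, 0 < r → ∀ u : Sph d, G (r • (u : Ed d)) = h r * f u) :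
    ∫ z, G z = (∫ u, f u ∂(ωd d)) * ∫ r in Set.Ioi (0 : ℝ), ((r ^ (d - 1) : ℝ) : ℂ) * h r := by
  have : Nonempty (Fin d) := ⟨⟨0, hd⟩⟩
  calc ∫ z, G z = ∫ x : ({(0 : Ed d)}ᶜ : Set (Ed d)), G x.1 ∂((volume : Measure (Ed d)).comap (↑)) := by
        rw [integral_subtype_comap (measurableSet_singleton _).compl G,
          restrict_compl_singleton]
    _ = ∫ x, f x.1 * h x.2 ∂(ωd d).prod (.volumeIoiPow (Module.finrank ℝ (Ed d) - 1)) := by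
        rw [ωd, ← (volume : Measure (Ed d)).measurePreserving_homeomorphUnitSphereProd.integral_comp
          (Homeomorph.measurableEmbedding _)]
        refine integral_congr_ae (ae_of_all _ fun x => ?_)
        have hx : 0 < ‖(x : Ed d)‖ := norm_pos_iff.2 x.2
        have e := hG ‖(x : Ed d)‖ hx (homeomorphUnitSphereProd (Ed d) x).1
        rw [homeomorphUnitSphereProd_apply_fst_coe, smul_smul, mul_inv_cancel₀ hx.ne', one_smul] at e
        simp only [homeomorphUnitSphereProd_apply_snd_coe]
        rw [e, mul_comm]
    _ = (∫ u, f u ∂(ωd d)) *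
          ∫ r : Set.Ioi (0 : ℝ), h r ∂.volumeIoiPow (Module.finrank ℝ (Ed d) - 1) :=
        have : SFinite (ωd d) := by unfold ωd; infer_instance
        integral_prod_mul f (fun r : Set.Ioi (0 : ℝ) => h r)
    _ = _ := by
        congr 1
        simp only [Measure.volumeIoiPow, ENNReal.ofReal, finrank_euclideanSpace, Fintype.card_fin]
        rw [integral_withDensity_eq_integral_smul
          ((measurable_subtype_coe.pow_const _).real_toNNReal),
          integral_subtype_comap measurableSet_Ioi fun a => Real.toNNReal (a ^ (d - 1)) • h a]
        refine setIntegral_congr_fun measurableSet_Ioi fun x hx => ?_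
        rw [NNReal.smul_def, Real.coe_toNNReal _ (pow_nonneg (le_of_lt hx) _), Complex.real_smul]

lemma integral_gaussian_polar {d : ℕ} (hd : 0 < d) {G : Ed d → ℂ} {p ε : ℝ} (hp : 0 ≤ p)
    (hε : 0 < ε) {f : Sph d → ℂ}
    (hG : ∀ r : ℝ, 0 < r → ∀ u : Sph d, G (r • (u : Ed d)) = ((r ^ p : ℝ) : ℂ) * f u) :
    ∫ z : Ed d, ((rexp (-ε * ‖z‖ ^ 2) : ℝ) : ℂ) * G z
      = ((1 / 2 * Gamma ((p + d) / 2) * ε ^ (-((p + d) / 2)) : ℝ) : ℂ) * ∫ u, f u ∂(ωd d) := by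
  rw [integral_polar hd (h := fun r => ((rexp (-ε * r ^ 2) * r ^ p : ℝ) : ℂ)) (f := f)]
  · rw [mul_comm]
    congr 1
    have h1 := integral_rpow_mul_exp_neg_mul_rpow (p := 2) (q := p + d - 1) (b := ε) two_pos
      (by have : (0 : ℝ) < d := by exact_mod_cast hd
          linarith) hε
    rw [show -(p + d - 1 + 1) / 2 = -((p + d) / 2) by ring,
      show (p + d - 1 + 1) / 2 = (p + d) / 2 by ring] at h1
    rw [show 1 / 2 * Gamma ((p + d) / 2) * ε ^ (-((p + d) / 2))
      = ε ^ (-((p + d) / 2)) * (1 / 2) * Gamma ((p + d) / 2) by ring, ← h1,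
      ← integral_complex_ofReal]
    refine setIntegral_congr_fun measurableSet_Ioi fun x hx => ?_
    have hx : 0 < x := hx
    rw [← Complex.ofReal_mul]
    congr 1
    rw [show p + d - 1 = ((d - 1 : ℕ) : ℝ) + p by rw [Nat.cast_sub hd]; push_cast; ring,
      rpow_add hx, rpow_natCast, rpow_two]
    ring
  · intro r hr u
    have hu : ‖(u : Ed d)‖ = 1 := by simp
    rw [hG r hr u, norm_smul, hu, mul_one, norm_of_nonneg hr.le]
    push_cast
    ring

lemma ev_smul_of_isHomogeneous {d j : ℕ} {Y : MvPolynomial (Fin d) ℂ} (hY : Y.IsHomogeneous j)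
    (r : ℝ) (x : Ed d) : ev Y (r • x) = (r : ℂ) ^ j * ev Y x := by
  rw [ev, ev, MvPolynomial.eval_eq, MvPolynomial.eval_eq, Finset.mul_sum]
  refine Finset.sum_congr rfl fun s hs => ?_
  have h := hY (MvPolynomial.mem_support_iff.1 hs)
  rw [← h, Finsupp.weight_apply, Finsupp.sum]
  simp only [PiLp.smul_apply, smul_eq_mul, Complex.ofReal_mul, mul_pow, Finset.prod_mul_distrib,
    Pi.one_apply, mul_one]
  rw [Finset.prod_pow_eq_pow_sum]
  ring

/-- A power of a linear form integrates against a harmonic polynomial over the sphere to a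
multiple of that polynomial. -/
lemma integral_inner_pow_mul_harmonic {d : ℕ} (hd : 0 < d) (x : Ed d) (m j : ℕ)
    {Y : MvPolynomial (Fin d) ℂ} (hY : Y.IsHomogeneous j) (hl : lap d Y = 0) :
    ∫ v, ((⟪x, (v : Ed d)⟫ : ℝ) : ℂ) ^ m * ev Y v ∂(ωd d)
      = monoMult d m j * (‖x‖ ^ 2 : ℝ) ^ ((m - j) / 2) * ev Y x := by
  have h1 := gaussInt_linForm_pow_mul x m j Y hY hl
  have h2 := integral_gaussian_polar hd (G := ev (linForm x ^ m * Y)) (p := (m : ℝ) + j) (ε := 1)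
    (by positivity) one_pos (f := fun v => ((⟪x, (v : Ed d)⟫ : ℝ) : ℂ) ^ m * ev Y v)
    (by
      intro r hr u
      rw [ev_mul, ev_pow, ev_linForm, ev_smul_of_isHomogeneous hY, real_inner_smul_right,
        ← Nat.cast_add, rpow_natCast]
      push_cast
      ring)
  simp only [neg_mul, one_mul] at h2
  rw [← gaussInt, h1, one_rpow, mul_one] at h2
  have hG : 0 < Gamma (((m : ℝ) + j + d) / 2) := Gamma_pos_of_pos (by positivity)
  have h3 : gaussMult d m j = 1 / 2 * Gamma (((m : ℝ) + j + d) / 2) * monoMult d m j := by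
    by_cases h : j ≤ m ∧ Even (m - j)
    · rw [gaussMult, monoMult, if_pos h, if_pos h]
      field_simp
    · rw [gaussMult_eq_zero h, monoMult_eq_zero h, mul_zero]
  rw [h3] at h2
  have hG' : ((1 / 2 * Gamma (((m : ℝ) + j + d) / 2) : ℝ) : ℂ) ≠ 0 := by
    exact_mod_cast (by positivity)
  refine mul_left_cancel₀ hG' (h2.symm.trans ?_)
  push_cast
  ring

lemma integral_sphere_one {d : ℕ} (hd : 0 < d) : (ωd d).real Set.univ = sphereArea d := by
  have h := integral_inner_pow_mul_harmonic hd 0 0 0 (Y := 1) (MvPolynomial.isHomogeneous_one _ _)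
    (by simp [lap_apply])
  simp [monoMult] at h
  rw [← Complex.ofReal_inj, h, sphereArea]
  push_cast
  rfl

instance {d : ℕ} : IsFiniteMeasure (ωd d) := by unfold ωd; infer_instance

instance {d : ℕ} : (ωd d).IsOpenPosMeasure := by unfold ωd; infer_instance

lemma norm_sph {d : ℕ} (u : Sph d) : ‖(u : Ed d)‖ = 1 := by simp

lemma inner_sph_mem {d : ℕ} (u v : Sph d) : ⟪(u : Ed d), (v : Ed d)⟫ ∈ Set.Icc (-1 : ℝ) 1 := by
  have := abs_real_inner_le_norm (u : Ed d) (v : Ed d)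
  rw [norm_sph, norm_sph, one_mul] at this
  exact abs_le.1 this

lemma integrable_sph {d : ℕ} {f : Sph d → ℂ} (hf : Continuous f) : Integrable f (ωd d) :=
  hf.integrable_of_hasCompactSupport (HasCompactSupport.of_compactSpace f)

lemma continuous_ev_sph {d : ℕ} (p : MvPolynomial (Fin d) ℂ) :
    Continuous fun v : Sph d => ev p v := (continuous_ev p).comp continuous_subtype_val

/-- Funk–Hecke formula for polynomial kernels. -/
lemma integral_polynomial_mul_harmonic {d : ℕ} (hd : 0 < d) (u : Sph d) (p : Polynomial ℝ) {l : ℕ}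
    {Y : MvPolynomial (Fin d) ℂ} (hY : Y.IsHomogeneous l) (hl : lap d Y = 0) :
    ∫ v, ((p.eval ⟪(u : Ed d), (v : Ed d)⟫ : ℝ) : ℂ) * ev Y v ∂(ωd d)
      = polyMult d l p * ev Y u := by
  have hc : ∀ p : Polynomial ℝ, Integrable (fun v : Sph d =>
      ((p.eval ⟪(u : Ed d), (v : Ed d)⟫ : ℝ) : ℂ) * ev Y v) (ωd d) := fun p =>
    integrable_sph ((Complex.continuous_ofReal.comp (p.continuous.comp (by fun_prop))).mul
      (continuous_ev_sph Y))
  induction p using Polynomial.induction_on' with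
  | add p r hp hr =>
    rw [polyMult_add]
    simp only [Polynomial.eval_add, Complex.ofReal_add, add_mul]
    rw [integral_add (hc p) (hc r), hp, hr]
  | monomial n a =>
    rw [← Polynomial.C_mul_X_pow_eq_monomial, polyMult_C_mul, polyMult_X_pow]
    have h := integral_inner_pow_mul_harmonic hd (u : Ed d) n l hY hl
    simp only [norm_sph, one_pow, Complex.ofReal_one, mul_one] at h
    simp only [Polynomial.eval_mul, Polynomial.eval_C, Polynomial.eval_pow, Polynomial.eval_X,
      Complex.ofReal_mul, Complex.ofReal_pow, mul_assoc]
    rw [integral_const_mul, h]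

lemma projC_harmonic {d : ℕ} (hd : 2 ≤ d) (j : ℕ) {l : ℕ} {Y : MvPolynomial (Fin d) ℂ}
    (hY : Y.IsHomogeneous l) (hl : lap d Y = 0) (u : Sph d) :
    projC d j (fun v => ev Y v) u = if l = j then ev Y u else 0 := by
  have hb : (0 : ℝ) ≤ ((d : ℝ) - 2) / 2 := by
    have : (2 : ℝ) ≤ d := by exact_mod_cast hd
    linarith
  rw [projC]
  simp only [gegenbauerN_eq hb]
  rw [integral_polynomial_mul_harmonic (by omega) u _ hY hl, polyMult_ultra hd]
  split_ifs with h
  · have h1 : (sphereArea d : ℂ) ≠ 0 := by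
      have : 0 < sphereArea d := by
        have : (0 : ℝ) < d := by exact_mod_cast (show 0 < d by omega)
        have := Gamma_pos_of_pos (half_pos this)
        rw [sphereArea]; positivity
      exact_mod_cast this.ne'
    have h2 : (cdim d j : ℂ) ≠ 0 := by
      obtain ⟨e, rfl⟩ : ∃ e, d = e + 2 := ⟨d - 2, by omega⟩
      exact_mod_cast (cdim_pos e j).ne'
    push_cast
    field_simp
  · simp

lemma projC_sum_harmonic {d : ℕ} (hd : 2 ≤ d) {n j : ℕ} (hj : j ≤ n)
    {Y : ℕ → MvPolynomial (Fin d) ℂ} (hY : ∀ l, (Y l).IsHomogeneous l ∧ lap d (Y l) = 0)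
    (u : Sph d) :
    projC d j (fun v => ∑ l ∈ Finset.range (n + 1), ev (Y l) v) u = ev (Y j) u := by
  have h : projC d j (fun v => ∑ l ∈ Finset.range (n + 1), ev (Y l) v) u
      = ∑ l ∈ Finset.range (n + 1), projC d j (fun v => ev (Y l) v) u := by
    have hb : (0 : ℝ) ≤ ((d : ℝ) - 2) / 2 := by
      have : (2 : ℝ) ≤ d := by exact_mod_cast hd
      linarith
    simp only [projC, gegenbauerN_eq hb, Finset.mul_sum]
    rw [integral_finsetSum, Finset.mul_sum]
    intro l _
    exact integrable_sph ((Complex.continuous_ofReal.comp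
      ((Polynomial.continuous _).comp (by fun_prop))).mul (continuous_ev_sph _))
  rw [h]
  simp only [projC_harmonic hd j (hY _).1 (hY _).2]
  rw [Finset.sum_ite_eq' _ j]
  simp [Nat.lt_succ_of_le hj]

lemma norm_projC_le {d : ℕ} (hd : 2 ≤ d) (j : ℕ) {f : Sph d → ℂ} {B : ℝ} (hf : ∀ v, ‖f v‖ ≤ B)
    (u : Sph d) : ‖projC d j f u‖ ≤ cdim d j * 3 ^ j * B := by
  have hb : (0 : ℝ) ≤ ((d : ℝ) - 2) / 2 := by
    have : (2 : ℝ) ≤ d := by exact_mod_cast hd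
    linarith
  have hA : 0 < sphereArea d := by
    have : (0 : ℝ) < d := by exact_mod_cast (show 0 < d by omega)
    have := Gamma_pos_of_pos (half_pos this)
    rw [sphereArea]; positivity
  have h : ‖∫ v, (gegenbauerN (((d : ℝ) - 2) / 2) j ⟪(u : Ed d), (v : Ed d)⟫ : ℂ) * f v ∂(ωd d)‖
      ≤ 3 ^ j * B * (ωd d).real Set.univ := by
    refine norm_integral_le_of_norm_le_const (ae_of_all _ fun v => ?_)
    rw [norm_mul, Complex.norm_real, gegenbauerN_eq hb]
    exact mul_le_mul (abs_ultra_eval_le hb j (abs_le.2 (inner_sph_mem u v))) (hf v)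
      (norm_nonneg _) (by positivity)
  rw [integral_sphere_one (by omega)] at h
  rw [projC, norm_mul, norm_div, Complex.norm_natCast, Complex.norm_real, norm_of_nonneg hA.le]
  calc _ ≤ (cdim d j : ℝ) / sphereArea d * (3 ^ j * B * sphereArea d) := by gcongr
    _ = _ := by field_simp

/-- Funk–Hecke formula for continuous kernels. -/
lemma exists_integral_mul_harmonic {d : ℕ} (hd : 0 < d) {f : ℝ → ℝ} (hf : Continuous f) {l : ℕ}
    {Y : MvPolynomial (Fin d) ℂ} (hY : Y.IsHomogeneous l) (hl : lap d Y = 0) :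
    ∃ c : ℂ, ∀ u : Sph d, ∫ v, ((f ⟪(u : Ed d), (v : Ed d)⟫ : ℝ) : ℂ) * ev Y v ∂(ωd d)
      = c * ev Y u := by
  have hp : ∀ n : ℕ, ∃ p : Polynomial ℝ, ∀ x ∈ Set.Icc (-1 : ℝ) 1,
      |p.eval x - f x| < 1 / ((n : ℝ) + 1) := fun n =>
    exists_polynomial_near_of_continuousOn (-1) 1 f hf.continuousOn _ (by positivity)
  choose p hp using hp
  have hlim : ∀ u : Sph d, Tendsto (fun n => (polyMult d l (p n) : ℂ) * ev Y u) atTop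
      (𝓝 (∫ v, ((f ⟪(u : Ed d), (v : Ed d)⟫ : ℝ) : ℂ) * ev Y v ∂(ωd d))) := by
    intro u
    simp only [← integral_polynomial_mul_harmonic hd u _ hY hl]
    refine tendsto_integral_of_dominated_convergence
      (fun v => (|f ⟪(u : Ed d), (v : Ed d)⟫| + 1) * ‖ev Y v‖) ?_ ?_ ?_ ?_
    · exact fun n => (integrable_sph ((Complex.continuous_ofReal.comp
        ((Polynomial.continuous _).comp (by fun_prop))).mul
          (continuous_ev_sph _))).aestronglyMeasurable
    · have : Continuous fun v : Sph d => (|f ⟪(u : Ed d), (v : Ed d)⟫| + 1) * ‖ev Y v‖ :=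
        (((hf.comp (by fun_prop)).abs).add continuous_const).mul (continuous_ev_sph Y).norm
      exact this.integrable_of_hasCompactSupport (HasCompactSupport.of_compactSpace _)
    · intro n
      refine ae_of_all _ fun v => ?_
      rw [norm_mul, Complex.norm_real, Real.norm_eq_abs]
      gcongr
      have h1 := hp n _ (inner_sph_mem u v)
      have h2 : 1 / ((n : ℝ) + 1) ≤ 1 := by
        rw [div_le_one (by positivity)]; linarith [Nat.cast_nonneg (α := ℝ) n]
      have h3 := abs_sub_abs_le_abs_sub ((p n).eval ⟪(u : Ed d), (v : Ed d)⟫)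
        (f ⟪(u : Ed d), (v : Ed d)⟫)
      linarith
    · refine ae_of_all _ fun v => Tendsto.mul_const _ ?_
      refine (Complex.continuous_ofReal.tendsto _).comp ?_
      rw [tendsto_iff_dist_tendsto_zero]
      exact squeeze_zero (fun _ => dist_nonneg) (fun n => (hp n _ (inner_sph_mem u v)).le)
        tendsto_one_div_add_atTop_nhds_zero_nat
  by_cases h0 : ∀ u : Sph d, ev Y u = 0
  · exact ⟨0, fun u => by simp [h0]⟩
  · push Not at h0
    obtain ⟨u₀, hu₀⟩ := h0
    refine ⟨_, fun u => tendsto_nhds_unique (hlim u)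
      (((hlim u₀).div_const (ev Y u₀)).congr (fun n => ?_) |>.mul_const _)⟩
    rw [mul_div_assoc, div_self hu₀, mul_one]

/-- The kernel of the characteristic exponent. -/
def stabKer (α t : ℝ) : ℂ :=
  (|t| ^ α : ℝ) * (1 - Complex.I * (Real.tan (Real.pi * α / 2) : ℂ) * (Real.sign t : ℂ))

lemma abs_rpow_mul_sign {α : ℝ} (hα : 0 < α) (t : ℝ) :
    |t| ^ α * Real.sign t = (max t 0) ^ α - (max (-t) 0) ^ α := by
  rcases lt_trichotomy t 0 with h | rfl | h
  · rw [sign_of_neg h, abs_of_neg h, max_eq_right h.le, max_eq_left (by linarith),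
      zero_rpow hα.ne']
    ring
  · simp
  · rw [sign_of_pos h, abs_of_pos h, max_eq_left h.le, max_eq_right (by linarith),
      zero_rpow hα.ne']
    ring

lemma continuous_abs_rpow_mul_sign {α : ℝ} (hα : 0 < α) :
    Continuous fun t : ℝ => |t| ^ α * Real.sign t := by
  simp only [abs_rpow_mul_sign hα]
  exact ((continuous_id.max continuous_const).rpow_const fun _ => Or.inr hα.le).sub
    ((continuous_neg.max continuous_const).rpow_const fun _ => Or.inr hα.le)

lemma stabKer_eq (α t : ℝ) : stabKer α t = ((|t| ^ α : ℝ) : ℂ) -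
    Complex.I * (Real.tan (Real.pi * α / 2) : ℂ) * ((|t| ^ α * Real.sign t : ℝ) : ℂ) := by
  rw [stabKer]
  push_cast
  ring

lemma continuous_abs_rpow {α : ℝ} (hα : 0 < α) : Continuous fun t : ℝ => |t| ^ α :=
  continuous_abs.rpow_const fun _ => Or.inr hα.le

lemma continuous_stabKer {α : ℝ} (hα : 0 < α) : Continuous (stabKer α) := by
  have : stabKer α = fun t => ((|t| ^ α : ℝ) : ℂ) - Complex.I *
    (Real.tan (Real.pi * α / 2) : ℂ) * ((|t| ^ α * Real.sign t : ℝ) : ℂ) := funext (stabKer_eq α)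
  rw [this]
  exact (Complex.continuous_ofReal.comp (continuous_abs_rpow hα)).sub
    (continuous_const.mul (Complex.continuous_ofReal.comp (continuous_abs_rpow_mul_sign hα)))

lemma stabKer_mul {α r : ℝ} (hr : 0 < r) (t : ℝ) :
    stabKer α (r * t) = ((r ^ α : ℝ) : ℂ) * stabKer α t := by
  have : Real.sign (r * t) = Real.sign t := by
    rcases lt_trichotomy t 0 with h | rfl | h
    · rw [sign_of_neg h, sign_of_neg (mul_neg_of_pos_of_neg hr h)]
    · simp
    · rw [sign_of_pos h, sign_of_pos (mul_pos hr h)]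
  rw [stabKer, stabKer, this, abs_mul, abs_of_pos hr, mul_rpow hr.le (abs_nonneg t)]
  push_cast
  ring

lemma stabKer_re (α t : ℝ) : (stabKer α t).re = |t| ^ α := by
  rw [stabKer_eq]
  simp [-Complex.ofReal_tan]

section

variable {d : ℕ} {α : ℝ} {P : Sph d → ℝ}

lemma charExp_eq (hP : Continuous P) (hP0 : ∀ u, 0 ≤ P u) (z : Ed d) :
    charExp d α (specMeasure d P) z
      = ∫ v, stabKer α ⟪z, (v : Ed d)⟫ * (P v : ℂ) ∂(ωd d) := by
  rw [charExp, specMeasure]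
  simp only [ENNReal.ofReal]
  rw [integral_withDensity_eq_integral_smul hP.measurable.real_toNNReal]
  refine integral_congr_ae (ae_of_all _ fun v => ?_)
  simp only
  rw [NNReal.smul_def, Real.coe_toNNReal _ (hP0 v), Complex.real_smul, stabKer, mul_comm]

lemma charExp_smul (hP : Continuous P) (hP0 : ∀ u, 0 ≤ P u) {r : ℝ} (hr : 0 < r) (z : Ed d) :
    charExp d α (specMeasure d P) (r • z)
      = ((r ^ α : ℝ) : ℂ) * charExp d α (specMeasure d P) z := by
  rw [charExp_eq hP hP0, charExp_eq hP hP0, ← integral_const_mul]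
  simp only [real_inner_smul_left, stabKer_mul hr, mul_assoc]

lemma continuous_charExp (hα : 0 < α) (hP : Continuous P) (hP0 : ∀ u, 0 ≤ P u) :
    Continuous (charExp d α (specMeasure d P)) := by
  have : charExp d α (specMeasure d P) = fun z =>
    ∫ v, stabKer α ⟪z, (v : Ed d)⟫ * (P v : ℂ) ∂(ωd d) := funext (charExp_eq hP hP0)
  rw [this]
  have h := continuous_parametric_integral_of_continuous (μ := ωd d) (s := Set.univ)
    (f := fun (z : Ed d) (v : Sph d) => stabKer α ⟪z, (v : Ed d)⟫ * (P v : ℂ))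
    (((continuous_stabKer hα).comp (by fun_prop)).mul
      (Complex.continuous_ofReal.comp (hP.comp continuous_snd))) isCompact_univ
  simpa using h

lemma charExp_zero (hα : 0 < α) (hP : Continuous P) (hP0 : ∀ u, 0 ≤ P u) :
    charExp d α (specMeasure d P) 0 = 0 := by
  rw [charExp_eq hP hP0]
  simp [stabKer, zero_rpow hα.ne']

lemma charExp_re (hα : 0 < α) (hP : Continuous P) (hP0 : ∀ u, 0 ≤ P u) (z : Ed d) :
    (charExp d α (specMeasure d P) z).re = ∫ v, |⟪z, (v : Ed d)⟫| ^ α * P v ∂(ωd d) := by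
  have hi : Integrable (fun v : Sph d => stabKer α ⟪z, (v : Ed d)⟫ * (P v : ℂ)) (ωd d) :=
    integrable_sph (((continuous_stabKer hα).comp (by fun_prop)).mul
      (Complex.continuous_ofReal.comp hP))
  rw [charExp_eq hP hP0]
  refine (integral_re hi).symm.trans (integral_congr_ae (ae_of_all _ fun v => ?_))
  simp [stabKer_re]

/-- The characteristic exponent restricted to the sphere is a polynomial. -/
lemma exists_Vfun_eq_ev (hd : 0 < d) (hα : 0 < α) {q : ℕ} (hpoly : IsPolyRestrictionDeg d q P)
    (hP : Continuous P) (hP0 : ∀ u, 0 ≤ P u) :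
    ∃ p : MvPolynomial (Fin d) ℂ, p.totalDegree ≤ q ∧
      ∀ u, Vfun d α (specMeasure d P) u = ev p u := by
  obtain ⟨p, hpq, hp⟩ := hpoly
  obtain ⟨Y, hY, hYe⟩ := HasHarmonicDecomp.of_totalDegree_le hd
    (p := MvPolynomial.map Complex.ofRealHom p) (n := q)
    ((Finset.sup_mono (MvPolynomial.support_map_subset _ _)).trans hpq)
  have hPY : ∀ v : Sph d, (P v : ℂ) = ∑ j ∈ Finset.range (q + 1), ev (Y j) v := by
    intro v
    have h1 := hYe (fun i => (((v : Ed d) i : ℝ) : ℂ)) (by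
      have := norm_sph v
      have h2 := EuclideanSpace.norm_sq_eq (v : Ed d)
      rw [this] at h2
      simp only [Real.norm_eq_abs, sq_abs, one_pow] at h2
      exact_mod_cast h2.symm)
    simp only [ev]
    rw [← h1, hp v, MvPolynomial.eval_map]
    exact (MvPolynomial.eval₂_comp_left Complex.ofRealHom (RingHom.id ℝ) _ p)
  choose c hc using fun j => exists_integral_mul_harmonic hd (continuous_abs_rpow hα)
    (hY j).1 (hY j).2
  choose c' hc' using fun j => exists_integral_mul_harmonic hd (continuous_abs_rpow_mul_sign hα)
    (hY j).1 (hY j).2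
  set τ : ℂ := Complex.I * (Real.tan (Real.pi * α / 2) : ℂ) with hτ
  refine ⟨∑ j ∈ Finset.range (q + 1), MvPolynomial.C (c j - τ * c' j) * Y j, ?_, fun u => ?_⟩
  · refine (MvPolynomial.totalDegree_finsetSum _ _).trans (Finset.sup_le fun j hj => ?_)
    refine (MvPolynomial.totalDegree_mul _ _).trans ?_
    rw [MvPolynomial.totalDegree_C, zero_add]
    exact (hY j).1.totalDegree_le.trans (Nat.le_of_lt_succ (Finset.mem_range.1 hj))
  · rw [Vfun, charExp_eq hP hP0, ev_sum]
    simp only [hPY, Finset.mul_sum]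
    rw [integral_finsetSum]
    · refine Finset.sum_congr rfl fun j _ => ?_
      simp only [stabKer_eq, sub_mul, ← hτ]
      rw [integral_sub]
      · simp only [mul_assoc τ]
        rw [integral_const_mul, hc, hc', ev_mul, ev_C]
        ring
      · exact integrable_sph ((Complex.continuous_ofReal.comp
          ((continuous_abs_rpow hα).comp (by fun_prop))).mul (continuous_ev_sph _))
      · exact integrable_sph ((continuous_const.mul (Complex.continuous_ofReal.comp
          ((continuous_abs_rpow_mul_sign hα).comp (by fun_prop)))).mul (continuous_ev_sph _))
    · exact fun j _ => integrable_sph (((continuous_stabKer hα).comp (by fun_prop)).mul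
        (continuous_ev_sph _))

/-- Spherical harmonic expansion of the powers of `V`. -/
lemma exists_Vfun_pow_decomp (hd : 2 ≤ d) (hα : 0 < α) {q : ℕ}
    (hpoly : IsPolyRestrictionDeg d q P) (hP : Continuous P) (hP0 : ∀ u, 0 ≤ P u) (k : ℕ) :
    ∃ Y : ℕ → MvPolynomial (Fin d) ℂ, (∀ j, (Y j).IsHomogeneous j ∧ lap d (Y j) = 0) ∧
      (∀ u, Vfun d α (specMeasure d P) u ^ k = ∑ j ∈ Finset.range (k * q + 1), ev (Y j) u) ∧
      ∀ j ≤ k * q, ∀ u, projC d j (fun v => Vfun d α (specMeasure d P) v ^ k) u = ev (Y j) u := by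
  obtain ⟨p, hpq, hp⟩ := exists_Vfun_eq_ev (by omega) hα hpoly hP hP0
  obtain ⟨Y, hY, hYe⟩ := HasHarmonicDecomp.of_totalDegree_le (show 0 < d by omega)
    (p := p ^ k) (n := k * q) ((MvPolynomial.totalDegree_pow _ _).trans (by gcongr))
  have hV : ∀ u, Vfun d α (specMeasure d P) u ^ k
      = ∑ j ∈ Finset.range (k * q + 1), ev (Y j) u := by
    intro u
    rw [hp, ← ev_pow]
    refine hYe (fun i => (((u : Ed d) i : ℝ) : ℂ)) ?_
    have := norm_sph u
    have h2 := EuclideanSpace.norm_sq_eq (u : Ed d)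
    rw [this] at h2
    simp only [Real.norm_eq_abs, sq_abs, one_pow] at h2
    exact_mod_cast h2.symm
  refine ⟨Y, hY, hV, fun j hj u => ?_⟩
  simp only [hV]
  exact projC_sum_harmonic hd hj hY u

end

section

variable {d : ℕ} {α : ℝ} {P : Sph d → ℝ}

/-- A nonzero function on the sphere does not vanish off a hyperplane. -/
lemma exists_ne_zero_inner_ne_zero (hP : Continuous P) (hPne : P ≠ 0) (u : Sph d) :
    ∃ v, P v ≠ 0 ∧ ⟪(u : Ed d), (v : Ed d)⟫ ≠ 0 := by
  obtain ⟨v₀, hv₀⟩ := Function.ne_iff.1 hPne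
  by_cases h : ⟪(u : Ed d), (v₀ : Ed d)⟫ = 0
  · have hmem : ∀ t : ℝ, Real.cos t • (v₀ : Ed d) + Real.sin t • (u : Ed d) ∈ Sph d := by
      intro t
      have h' : ⟪(v₀ : Ed d), (u : Ed d)⟫ = 0 := by rw [real_inner_comm, h]
      rw [mem_sphere_iff_norm, sub_zero, ← pow_left_inj₀ (norm_nonneg _) zero_le_one two_ne_zero,
        norm_add_sq_real, norm_smul, norm_smul, norm_sph, norm_sph, real_inner_smul_left,
        real_inner_smul_right, h']
      simp
    have hcont : Continuous fun t : ℝ => (⟨_, hmem t⟩ : Sph d) := by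
      refine Continuous.subtype_mk ?_ _
      fun_prop
    have h1 : ∀ᶠ t : ℝ in 𝓝 0, P ⟨_, hmem t⟩ ≠ 0 := by
      refine ((hP.comp hcont).tendsto 0).eventually_ne ?_
      simpa using hv₀
    have h2 : ∀ᶠ t : ℝ in 𝓝[>] 0, 0 < t ∧ t < π :=
      (eventually_mem_nhdsWithin).and (eventually_nhdsWithin_of_eventually_nhds
        (eventually_lt_nhds pi_pos))
    obtain ⟨t, ht, h0, hπ⟩ := ((eventually_nhdsWithin_of_eventually_nhds h1).and h2).exists
    refine ⟨_, ht, ?_⟩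
    have hs := sin_pos_of_pos_of_lt_pi h0 hπ
    have hu : ⟪(u : Ed d), (u : Ed d)⟫ = 1 := by rw [real_inner_self_eq_norm_sq, norm_sph, one_pow]
    simp only [inner_add_right, real_inner_smul_right, h, hu]
    simpa using hs.ne'
  · exact ⟨v₀, hv₀, h⟩

lemma charExp_re_pos (hα : 0 < α) (hP : Continuous P) (hP0 : ∀ u, 0 ≤ P u) (hPne : P ≠ 0)
    (u : Sph d) : 0 < (charExp d α (specMeasure d P) u).re := by
  obtain ⟨v, hv, huv⟩ := exists_ne_zero_inner_ne_zero hP hPne u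
  rw [charExp_re hα hP hP0]
  refine Continuous.integral_pos_of_hasCompactSupport_nonneg_nonzero (x := v)
    (((continuous_abs_rpow hα).comp (by fun_prop)).mul hP) (HasCompactSupport.of_compactSpace _)
    (fun v => mul_nonneg (by positivity) (hP0 v)) ?_
  exact mul_ne_zero (rpow_pos_of_pos (abs_pos.2 huv) _).ne' hv

lemma norm_smul_unitize (z : Ed d) (hz : z ≠ 0) : ‖z‖ • (unitize z hz : Ed d) = z := by
  rw [unitize, smul_smul, mul_inv_cancel₀ (norm_ne_zero_iff.2 hz), one_smul]

lemma exists_charExp_re_ge (hd : 0 < d) (hα : 0 < α) (hP : Continuous P) (hP0 : ∀ u, 0 ≤ P u)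
    (hPne : P ≠ 0) :
    ∃ c : ℝ, 0 < c ∧ ∀ z : Ed d, c * ‖z‖ ^ α ≤ (charExp d α (specMeasure d P) z).re := by
  have : Nonempty (Fin d) := ⟨⟨0, hd⟩⟩
  have hne : Nonempty (Sph d) := (NormedSpace.sphere_nonempty.2 zero_le_one).to_subtype
  have hc : Continuous fun u : Sph d => (charExp d α (specMeasure d P) u).re :=
    Complex.continuous_re.comp ((continuous_charExp hα hP hP0).comp continuous_subtype_val)
  obtain ⟨u₀, -, hu₀⟩ := isCompact_univ.exists_isMinOn Set.univ_nonempty hc.continuousOn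
  refine ⟨_, charExp_re_pos hα hP hP0 hPne u₀, fun z => ?_⟩
  by_cases hz : z = 0
  · rw [hz, charExp_zero hα hP hP0, norm_zero, zero_rpow hα.ne']
    simp
  · have h := charExp_smul (α := α) hP hP0 (norm_pos_iff.2 hz) (unitize z hz : Ed d)
    rw [norm_smul_unitize] at h
    rw [h, Complex.re_ofReal_mul, mul_comm]
    exact mul_le_mul_of_nonneg_left (hu₀ (Set.mem_univ (unitize z hz))) (by positivity)

lemma exists_norm_charExp_le (hα : 0 < α) (hP : Continuous P) (hP0 : ∀ u, 0 ≤ P u) :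
    ∃ K : ℝ, 0 ≤ K ∧ (∀ u, ‖Vfun d α (specMeasure d P) u‖ ≤ K) ∧
      ∀ z : Ed d, ‖charExp d α (specMeasure d P) z‖ ≤ K * ‖z‖ ^ α := by
  have hc : Continuous fun u : Sph d => charExp d α (specMeasure d P) u :=
    (continuous_charExp hα hP hP0).comp continuous_subtype_val
  obtain ⟨K, hK⟩ := isCompact_univ.exists_bound_of_continuousOn hc.continuousOn
  refine ⟨max K 0, le_max_right _ _, fun u => (hK u trivial).trans (le_max_left _ _), fun z => ?_⟩
  by_cases hz : z = 0
  · rw [hz, charExp_zero hα hP hP0, norm_zero]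
    positivity
  · have h := charExp_smul (α := α) hP hP0 (norm_pos_iff.2 hz) (unitize z hz : Ed d)
    rw [norm_smul_unitize] at h
    rw [h, norm_mul, Complex.norm_real, norm_of_nonneg (by positivity), mul_comm]
    exact mul_le_mul_of_nonneg_right ((hK _ trivial).trans (le_max_left _ _)) (by positivity)

lemma integrable_exp_neg_mul_norm_rpow (hd : 0 < d) (hα : 0 < α) {c : ℝ} (hc : 0 < c) :
    Integrable fun z : Ed d => rexp (-c * ‖z‖ ^ α) := by
  have : Nonempty (Fin d) := ⟨⟨0, hd⟩⟩
  refine (integrable_fun_norm_addHaar (volume : Measure (Ed d))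
    (f := fun t => rexp (-c * t ^ α))).2 ?_
  rw [finrank_euclideanSpace, Fintype.card_fin]
  have hd' : (0 : ℝ) < d := by exact_mod_cast hd
  have h := integral_rpow_mul_exp_neg_mul_rpow (p := α) (q := (d : ℝ) - 1) hα (by linarith) hc
  have hG : 0 < Gamma (((d : ℝ) - 1 + 1) / α) := Gamma_pos_of_pos (by
    rw [sub_add_cancel]; positivity)
  have hi : IntegrableOn (fun x : ℝ => x ^ ((d : ℝ) - 1) * rexp (-c * x ^ α)) (Set.Ioi 0) :=
    Integrable.of_integral_ne_zero (by rw [h]; positivity)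
  refine hi.congr_fun (fun x hx => ?_) measurableSet_Ioi
  simp only [smul_eq_mul]
  rw [← rpow_natCast, Nat.cast_sub hd, Nat.cast_one]

lemma integrable_exp_neg_charExp (hd : 0 < d) (hα : 0 < α) (hP : Continuous P)
    (hP0 : ∀ u, 0 ≤ P u) (hPne : P ≠ 0) :
    Integrable fun z : Ed d => Complex.exp (-charExp d α (specMeasure d P) z) := by
  obtain ⟨c, hc, h⟩ := exists_charExp_re_ge hd hα hP hP0 hPne
  refine (integrable_exp_neg_mul_norm_rpow hd hα hc).mono'
    (Complex.continuous_exp.comp (continuous_charExp hα hP hP0).neg).aestronglyMeasurable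
    (ae_of_all _ fun z => ?_)
  rw [Complex.norm_exp]
  refine exp_le_exp.2 ?_
  rw [Complex.neg_re]
  linarith [h z]

end

lemma integrable_gaussian_mul_exp {d : ℕ} {α ε a K : ℝ} (hε : 0 < ε) (hK : 0 ≤ K)
    (hα0 : 0 < α) (hα1 : α < 1) :
    Integrable fun z : Ed d => rexp (-ε * ‖z‖ ^ 2) * (rexp (a * ‖z‖) * rexp (K * ‖z‖ ^ α)) := by
  refine ((integrable_exp_neg_mul_sq_norm (d := d) (half_pos hε)).const_mul
    (rexp (K + (a + K) ^ 2 / (2 * ε)))).mono' ?_ (ae_of_all _ fun z => ?_)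
  · refine Continuous.aestronglyMeasurable ?_
    have : Continuous fun z : Ed d => ‖z‖ ^ α := continuous_norm.rpow_const fun _ => Or.inr hα0.le
    fun_prop
  · rw [norm_of_nonneg (by positivity), ← exp_add, ← exp_add, ← exp_add]
    refine exp_le_exp.2 ?_
    have h1 : ‖z‖ ^ α ≤ 1 + ‖z‖ := by
      rcases le_total ‖z‖ 1 with h | h
      · exact (rpow_le_one (norm_nonneg _) h hα0.le).trans (by linarith [norm_nonneg z])
      · have := rpow_le_rpow_of_exponent_le h hα1.le
        rw [rpow_one] at this
        linarith
    have h2 : K * ‖z‖ ^ α ≤ K * (1 + ‖z‖) := by gcongr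
    have h3 : (a + K) * ‖z‖ ≤ (a + K) ^ 2 / (2 * ε) + ε / 2 * ‖z‖ ^ 2 := by
      rw [← sub_nonneg]
      have : (a + K) ^ 2 / (2 * ε) + ε / 2 * ‖z‖ ^ 2 - (a + K) * ‖z‖
        = ((a + K) - ε * ‖z‖) ^ 2 / (2 * ε) := by field_simp; ring
      rw [this]
      positivity
    linarith

section

variable {d : ℕ} {α : ℝ} {P : Sph d → ℝ}

/-- The Gaussian-regularized Fourier integral of a power of the characteristic exponent. -/
def regInt (d : ℕ) (α : ℝ) (P : Sph d → ℝ) (k : ℕ) (ε : ℝ) (x : Ed d) : ℂ :=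
  ∫ z : Ed d, Complex.exp (-(Complex.I * (⟪x, z⟫ : ℂ))) * ((rexp (-ε * ‖z‖ ^ 2) : ℝ) : ℂ) *
    charExp d α (specMeasure d P) z ^ k

lemma norm_exp_neg_I_mul (t : ℝ) : ‖Complex.exp (-(Complex.I * (t : ℂ)))‖ = 1 := by
  simp [Complex.norm_exp]

lemma hasSum_regInt (hα0 : 0 < α) (hα1 : α < 1) (hP : Continuous P) (hP0 : ∀ u, 0 ≤ P u)
    {ε : ℝ} (hε : 0 < ε) (x : Ed d) :
    HasSum (fun k : ℕ => (-1) ^ k / (k.factorial : ℂ) * regInt d α P k ε x)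
      (∫ z : Ed d, Complex.exp (-(Complex.I * (⟪x, z⟫ : ℂ))) *
        ((rexp (-ε * ‖z‖ ^ 2) : ℝ) : ℂ) * Complex.exp (-charExp d α (specMeasure d P) z)) := by
  obtain ⟨K, hK0, -, hK⟩ := exists_norm_charExp_le hα0 hP hP0
  have hc := continuous_charExp hα0 hP hP0
  have hs : ∀ t : ℝ, HasSum (fun k : ℕ => t ^ k / k.factorial) (rexp t) := fun t => by
    rw [Real.exp_eq_exp_ℝ]
    exact NormedSpace.expSeries_div_hasSum_exp t
  have hs' : ∀ z : Ed d, HasSum (fun k : ℕ => rexp (-ε * ‖z‖ ^ 2) *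
      ((K * ‖z‖ ^ α) ^ k / k.factorial)) (rexp (-ε * ‖z‖ ^ 2) * rexp (K * ‖z‖ ^ α)) :=
    fun z => (hs _).mul_left _
  have h := hasSum_integral_of_dominated_convergence (μ := (volume : Measure (Ed d)))
    (F := fun (k : ℕ) (z : Ed d) => (-1) ^ k / (k.factorial : ℂ) *
      (Complex.exp (-(Complex.I * (⟪x, z⟫ : ℂ))) * ((rexp (-ε * ‖z‖ ^ 2) : ℝ) : ℂ) *
        charExp d α (specMeasure d P) z ^ k))
    (f := fun z => Complex.exp (-(Complex.I * (⟪x, z⟫ : ℂ))) *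
        ((rexp (-ε * ‖z‖ ^ 2) : ℝ) : ℂ) * Complex.exp (-charExp d α (specMeasure d P) z))
    (fun (k : ℕ) (z : Ed d) => rexp (-ε * ‖z‖ ^ 2) * ((K * ‖z‖ ^ α) ^ k / k.factorial))
    (fun k => Continuous.aestronglyMeasurable (by fun_prop))
    (fun k => ae_of_all _ fun z => by
      rw [norm_mul, norm_mul, norm_mul, norm_exp_neg_I_mul, norm_div, norm_pow, norm_pow,
        Complex.norm_real, Complex.norm_natCast, norm_of_nonneg (exp_pos _).le, norm_neg, norm_one,
        one_pow, one_mul, one_div_mul_eq_div, mul_div_assoc]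
      gcongr
      exact hK z)
    (ae_of_all _ fun z => (hs' z).summable)
    (by
      simp only [(hs' _).tsum_eq]
      simpa using integrable_gaussian_mul_exp (d := d) (a := 0) hε hK0 hα0 hα1)
    (ae_of_all _ fun z => by
      have h1 := NormedSpace.expSeries_div_hasSum_exp (-charExp d α (specMeasure d P) z)
      rw [← Complex.exp_eq_exp_ℂ] at h1
      refine (h1.mul_left (Complex.exp (-(Complex.I * (⟪x, z⟫ : ℂ))) *
        ((rexp (-ε * ‖z‖ ^ 2) : ℝ) : ℂ))).congr_fun fun k => ?_
      rw [neg_pow]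
      ring)
  simp only [integral_const_mul] at h
  exact h

lemma regInt_hasSum_inner_pow (hα0 : 0 < α) (hα1 : α < 1) (hP : Continuous P)
    (hP0 : ∀ u, 0 ≤ P u) {ε : ℝ} (hε : 0 < ε) (x : Ed d) (k : ℕ) :
    HasSum (fun m : ℕ => (-Complex.I) ^ m / (m.factorial : ℂ) *
      ∫ z : Ed d, ((rexp (-ε * ‖z‖ ^ 2) : ℝ) : ℂ) * ((⟪x, z⟫ : ℂ) ^ m *
        charExp d α (specMeasure d P) z ^ k)) (regInt d α P k ε x) := by
  obtain ⟨K, hK0, -, hK⟩ := exists_norm_charExp_le hα0 hP hP0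
  have hc := continuous_charExp hα0 hP hP0
  have hs : ∀ t : ℝ, HasSum (fun k : ℕ => t ^ k / k.factorial) (rexp t) := fun t => by
    rw [Real.exp_eq_exp_ℝ]
    exact NormedSpace.expSeries_div_hasSum_exp t
  have hs' : ∀ z : Ed d, HasSum (fun m : ℕ => rexp (-ε * ‖z‖ ^ 2) * (K * ‖z‖ ^ α) ^ k *
      ((‖x‖ * ‖z‖) ^ m / m.factorial))
        (rexp (-ε * ‖z‖ ^ 2) * (K * ‖z‖ ^ α) ^ k * rexp (‖x‖ * ‖z‖)) :=
    fun z => (hs _).mul_left _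
  have h := hasSum_integral_of_dominated_convergence (μ := (volume : Measure (Ed d)))
    (F := fun (m : ℕ) (z : Ed d) => (-Complex.I) ^ m / (m.factorial : ℂ) *
      (((rexp (-ε * ‖z‖ ^ 2) : ℝ) : ℂ) * ((⟪x, z⟫ : ℂ) ^ m *
        charExp d α (specMeasure d P) z ^ k)))
    (f := fun z => Complex.exp (-(Complex.I * (⟪x, z⟫ : ℂ))) *
        ((rexp (-ε * ‖z‖ ^ 2) : ℝ) : ℂ) * charExp d α (specMeasure d P) z ^ k)
    (fun (m : ℕ) (z : Ed d) => rexp (-ε * ‖z‖ ^ 2) * (K * ‖z‖ ^ α) ^ k *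
      ((‖x‖ * ‖z‖) ^ m / m.factorial))
    (fun m => Continuous.aestronglyMeasurable (by fun_prop))
    (fun m => ae_of_all _ fun z => by
      rw [norm_mul, norm_mul, norm_mul, norm_div, norm_pow, norm_pow, norm_pow,
        Complex.norm_real, Complex.norm_natCast, norm_of_nonneg (exp_pos _).le, norm_neg,
        Complex.norm_I, Complex.norm_real, one_pow, one_div_mul_eq_div, ← mul_div_assoc,
        mul_comm (‖⟪x, z⟫‖ ^ m), ← mul_assoc]
      gcongr
      · exact hK z
      · exact abs_real_inner_le_norm x z)
    (ae_of_all _ fun z => (hs' z).summable)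
    (by
      simp only [(hs' _).tsum_eq]
      refine ((integrable_gaussian_mul_exp (d := d) (a := ‖x‖) hε hK0 hα0 hα1).const_mul
        (k.factorial : ℝ)).mono' ?_ (ae_of_all _ fun z => ?_)
      · refine Continuous.aestronglyMeasurable ?_
        have : Continuous fun z : Ed d => ‖z‖ ^ α :=
          continuous_norm.rpow_const fun _ => Or.inr hα0.le
        fun_prop
      · rw [norm_of_nonneg (by positivity)]
        have h1 := Real.pow_div_factorial_le_exp (K * ‖z‖ ^ α) (by positivity) k
        rw [div_le_iff₀ (by positivity)] at h1
        calc _ ≤ rexp (-ε * ‖z‖ ^ 2) * (rexp (K * ‖z‖ ^ α) * k.factorial) * rexp (‖x‖ * ‖z‖) := by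
              refine mul_le_mul_of_nonneg_right (mul_le_mul_of_nonneg_left h1 ?_) ?_ <;> positivity
          _ = _ := by ring)
    (ae_of_all _ fun z => by
      have h1 := NormedSpace.expSeries_div_hasSum_exp (-(Complex.I * (⟪x, z⟫ : ℂ)))
      rw [← Complex.exp_eq_exp_ℂ] at h1
      have h2 := h1.mul_right (((rexp (-ε * ‖z‖ ^ 2) : ℝ) : ℂ) *
        charExp d α (specMeasure d P) z ^ k)
      rw [← mul_assoc] at h2
      refine h2.congr_fun fun m => ?_
      rw [← neg_mul, mul_pow]
      ring)
  simp only [integral_const_mul] at h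
  exact h

end

section

variable {d : ℕ} {α : ℝ} {P : Sph d → ℝ}

lemma integral_gaussian_inner_pow (hd : 0 < d) (hα : 0 < α) (hP : Continuous P)
    (hP0 : ∀ u, 0 ≤ P u) {ε : ℝ} (hε : 0 < ε) (x : Ed d) (k m : ℕ) {n : ℕ}
    {Y : ℕ → MvPolynomial (Fin d) ℂ} (hY : ∀ j, (Y j).IsHomogeneous j ∧ lap d (Y j) = 0)
    (hV : ∀ u, Vfun d α (specMeasure d P) u ^ k = ∑ j ∈ Finset.range n, ev (Y j) u) :
    ∫ z : Ed d, ((rexp (-ε * ‖z‖ ^ 2) : ℝ) : ℂ) * ((⟪x, z⟫ : ℂ) ^ m *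
        charExp d α (specMeasure d P) z ^ k)
      = ∑ j ∈ Finset.range n, ((1 / 2 * Gamma ((m + k * α + d) / 2) *
          ε ^ (-((m + k * α + d) / 2)) * monoMult d m j * (‖x‖ ^ 2) ^ ((m - j) / 2) : ℝ) : ℂ) *
            ev (Y j) x := by
  rw [integral_gaussian_polar hd (p := m + k * α) (by positivity) hε
    (f := fun u => (⟪x, (u : Ed d)⟫ : ℂ) ^ m * Vfun d α (specMeasure d P) u ^ k)]
  · simp only [hV, Finset.mul_sum]
    rw [integral_finsetSum]
    · rw [Finset.mul_sum]
      refine Finset.sum_congr rfl fun j _ => ?_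
      rw [integral_inner_pow_mul_harmonic hd x m j (hY j).1 (hY j).2]
      push_cast
      ring
    · exact fun j _ => integrable_sph (((Complex.continuous_ofReal.comp (by fun_prop)).pow m).mul
        (continuous_ev_sph _))
  · intro r hr u
    rw [charExp_smul hP hP0 hr, real_inner_smul_right, rpow_add hr, rpow_natCast,
      mul_comm (k : ℝ) α, rpow_mul hr.le, rpow_natCast, Vfun]
    push_cast
    ring

/-- The contribution of a degree `j` harmonic to the regularized integral. -/
lemma hasSum_monoMult {j : ℕ} {s ε ρ : ℝ} (hd : 0 < d) (hs : 0 ≤ s) (hε : 0 < ε) (hρ : 0 < ρ) :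
    HasSum (fun m : ℕ => (-Complex.I) ^ m / (m.factorial : ℂ) *
      ((1 / 2 * Gamma ((m + s + d) / 2) * ε ^ (-((m + s + d) / 2)) * monoMult d m j *
        (ρ ^ 2) ^ ((m - j) / 2) * ρ ^ j : ℝ) : ℂ))
      ((-Complex.I) ^ j * ((π ^ ((d : ℝ) / 2) * (2 / ρ) ^ (s + d) *
        ((ρ ^ 2 / (4 * ε)) ^ ((j + s + d) / 2) *
          kummer ((j + s + d) / 2) (j + (d : ℝ) / 2) (ρ ^ 2 / (4 * ε))) : ℝ) : ℂ)) := by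
  have hd' : (0 : ℝ) < d := by exact_mod_cast hd
  have hinj : Function.Injective fun i : ℕ => j + 2 * i := fun a b h => by
    simp only at h; omega
  rw [← hinj.hasSum_iff]
  · set A : ℝ := (j + s + d) / 2 with hA
    set B : ℝ := j + (d : ℝ) / 2 with hB
    set y : ℝ := ρ ^ 2 / (4 * ε) with hy
    have hA0 : 0 < A := by positivity
    have hB0 : 0 < B := by positivity
    have h := (summable_kummerTerm hA0 hB0 y).hasSum
    have h' := (h.mul_left (π ^ ((d : ℝ) / 2) * ε ^ (-A) * (ρ / 2) ^ j))
    have hyA : y ^ A = (ρ / 2) ^ j * (ρ / 2) ^ (s + d) * ε ^ (-A) := by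
      rw [hy, show ρ ^ 2 / (4 * ε) = (ρ / 2) ^ 2 * ε⁻¹ by field_simp; norm_num,
        mul_rpow (by positivity) (by positivity), inv_rpow hε.le, ← rpow_neg hε.le, ← rpow_two,
        ← rpow_mul (by positivity), ← rpow_natCast, ← rpow_add (by positivity),
        show 2 * A = j + (s + d) by rw [hA]; ring]
    have hρs : (2 / ρ) ^ (s + d) * (ρ / 2) ^ (s + d) = 1 := by
      rw [← mul_rpow (by positivity) (by positivity),
        show 2 / ρ * (ρ / 2) = 1 by field_simp, one_rpow]
    have hval : π ^ ((d : ℝ) / 2) * (2 / ρ) ^ (s + d) * (y ^ A * kummer A B y)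
        = π ^ ((d : ℝ) / 2) * ε ^ (-A) * (ρ / 2) ^ j * kummer A B y := by
      rw [hyA]
      linear_combination π ^ ((d : ℝ) / 2) * ε ^ (-A) * (ρ / 2) ^ j * kummer A B y * hρs
    rw [hval]
    refine ((Complex.hasSum_ofReal.2 h').mul_left ((-Complex.I) ^ j)).congr_fun fun i => ?_
    simp only [Function.comp_apply]
    rw [monoMult_add, show (j + 2 * i - j) / 2 = i by omega, kummerTerm]
    have e1 : (((j + 2 * i : ℕ) : ℝ) + s + d) / 2 = A + i := by rw [hA]; push_cast; ring
    have e2 : (j : ℝ) + i + (d : ℝ) / 2 = B + i := by rw [hB]; ring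
    have e3 : ε ^ (-(A + i)) = ε ^ (-A) * (ε ^ i)⁻¹ := by
      rw [neg_add, rpow_add hε, rpow_neg hε.le (i : ℝ), rpow_natCast]
    have hI : (-Complex.I) ^ (j + 2 * i) = (-Complex.I) ^ j * ((((-1) ^ i : ℝ)) : ℂ) := by
      rw [pow_add, pow_mul]
      simp
    have hG : 0 < Gamma (B + i) := Gamma_pos_of_pos (by positivity)
    rw [e1, e2, e3, hI, ← Complex.ofReal_natCast, mul_div_assoc, ← Complex.ofReal_div, mul_assoc,
      ← Complex.ofReal_mul]
    congr 2
    have hy' : (-y) ^ i = (-1) ^ i * (ρ ^ 2) ^ i * ((4 : ℝ) ^ i)⁻¹ * (ε ^ i)⁻¹ := by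
      rw [hy, neg_pow, div_pow, mul_pow]
      field_simp
    rw [hy', div_pow]
    have := (j + 2 * i).factorial_ne_zero
    field_simp
  · intro m hm
    rw [monoMult_eq_zero]
    · simp
    · rintro ⟨h1, i, hi⟩
      exact hm ⟨i, by simp only; omega⟩

lemma regInt_eq (hd : 0 < d) (hα0 : 0 < α) (hα1 : α < 1) (hP : Continuous P)
    (hP0 : ∀ u, 0 ≤ P u) {ε : ℝ} (hε : 0 < ε) (x : Ed d) (hx : x ≠ 0) (k : ℕ) {n : ℕ}
    {Y : ℕ → MvPolynomial (Fin d) ℂ} (hY : ∀ j, (Y j).IsHomogeneous j ∧ lap d (Y j) = 0)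
    (hV : ∀ u, Vfun d α (specMeasure d P) u ^ k = ∑ j ∈ Finset.range n, ev (Y j) u) :
    regInt d α P k ε x = ∑ j ∈ Finset.range n,
      (-Complex.I) ^ j * ((π ^ ((d : ℝ) / 2) * (2 / ‖x‖) ^ (k * α + d) *
        ((‖x‖ ^ 2 / (4 * ε)) ^ ((j + k * α + d) / 2) *
          kummer ((j + k * α + d) / 2) (j + (d : ℝ) / 2) (‖x‖ ^ 2 / (4 * ε))) : ℝ) : ℂ) *
            ev (Y j) (unitize x hx) := by
  have hρ : 0 < ‖x‖ := norm_pos_iff.2 hx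
  have h1 := regInt_hasSum_inner_pow hα0 hα1 hP hP0 hε x k
  simp only [integral_gaussian_inner_pow hd hα0 hP hP0 hε x k _ hY hV] at h1
  have h2 := hasSum_sum (s := Finset.range n) fun j _ =>
    (hasSum_monoMult (d := d) (j := j) (s := k * α) hd (by positivity) hε hρ).mul_right
      (ev (Y j) (unitize x hx))
  refine h1.unique (h2.congr_fun fun m => ?_)
  rw [Finset.mul_sum]
  refine Finset.sum_congr rfl fun j _ => ?_
  have h3 : ev (Y j) x = ((‖x‖ : ℝ) : ℂ) ^ j * ev (Y j) (unitize x hx) := by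
    rw [← ev_smul_of_isHomogeneous (hY j).1, norm_smul_unitize]
  rw [h3]
  push_cast
  ring

end

lemma IsPolyRestrictionDeg.continuous {d q : ℕ} {P : Sph d → ℝ}
    (h : IsPolyRestrictionDeg d q P) : Continuous P := by
  obtain ⟨p, -, hp⟩ := h
  rw [funext hp]
  exact (MvPolynomial.continuous_eval p).comp (by fun_prop)

/-- The radial factor of the `k`-th term of the series. -/
def radCoeff (d : ℕ) (α : ℝ) (k : ℕ) (ρ : ℝ) : ℝ :=
  (-((2 : ℝ) ^ α)) ^ k * π ^ (-(d : ℝ) / 2) / ((k.factorial : ℝ) * ρ ^ ((k : ℝ) * α + d))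

/-- The regularized analogue of `Γ((j + kα + d) / 2) / Γ((j - kα) / 2)`, which is its limit as
`y → ∞`. -/
def regCoeff (d : ℕ) (α : ℝ) (j k : ℕ) (y : ℝ) : ℝ :=
  y ^ (((j : ℝ) + k * α + d) / 2) * kummer (((j : ℝ) + k * α + d) / 2) (j + (d : ℝ) / 2) y

section

variable {d q : ℕ} {α : ℝ} {P : Sph d → ℝ}

lemma tendsto_regCoeff (hd : 0 < d) (hα : 0 < α) (j k : ℕ) :
    Tendsto (regCoeff d α j k) atTop
      (𝓝 (Gamma (((j : ℝ) + k * α + d) / 2) / Gamma (((j : ℝ) - k * α) / 2))) := by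
  have hd' : (0 : ℝ) < d := by exact_mod_cast hd
  obtain ⟨N, hN⟩ := exists_nat_ge
    (2 - ((j : ℝ) + (d : ℝ) / 2 - ((j : ℝ) + k * α + d) / 2))
  have h := tendsto_kummer N (A := ((j : ℝ) + k * α + d) / 2) (B := j + (d : ℝ) / 2)
    (by positivity) (by positivity) (by linarith)
  rwa [show (j : ℝ) + (d : ℝ) / 2 - ((j : ℝ) + k * α + d) / 2 = ((j : ℝ) - k * α) / 2 by ring] at h

lemma abs_Gamma_quotient_le (hd : 2 ≤ d) (hα0 : 0 < α) (hα1 : α < 1) {j k : ℕ} (hj : j ≤ k * q) :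
    |Gamma (((j : ℝ) + k * α + d) / 2) / Gamma (((j : ℝ) - k * α) / 2)| / k.factorial
      ≤ d.factorial * (2 * ((2 * q + 4) * rexp 1)) ^ (k + d) /
        Gamma (k * (1 - α) + (d : ℝ) / 2) :=
  le_of_tendsto (((tendsto_regCoeff (by omega) hα0 j k).abs).div_const _)
    ((eventually_gt_atTop 0).mono fun _ hy => kummer_coeff_bound hd hα0 hα1 hj hy)

lemma exists_summable_bound (hd : 2 ≤ d) (hα0 : 0 < α) (hα1 : α < 1) (hP : Continuous P)
    (hP0 : ∀ u, 0 ≤ P u) (q : ℕ) {r : ℝ} (hr : 0 < r) :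
    ∃ M : ℕ → ℝ, Summable M ∧ ∀ (k : ℕ) (c : ℕ → ℝ),
      (∀ j ≤ k * q, |c j| / k.factorial ≤ d.factorial * (2 * ((2 * q + 4) * rexp 1)) ^ (k + d) /
        Gamma (k * (1 - α) + (d : ℝ) / 2)) →
      ∀ (ρ : ℝ) (u : Sph d), r ≤ ρ →
        ∑ j ∈ Finset.range (k * q + 1),
          ‖((radCoeff d α k ρ * c j : ℝ) : ℂ) * SHk d α (specMeasure d P) j k u‖ ≤ M k := by
  obtain ⟨K, hK0, hK, -⟩ := exists_norm_charExp_le hα0 hP hP0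
  set E : ℝ := 2 * ((2 * q + 4) * rexp 1) with hE
  have hd2 : (2 : ℝ) ≤ d := by exact_mod_cast hd
  have hE0 : 0 ≤ E := by positivity
  set C : ℝ := 2 ^ α * (r ^ α)⁻¹ * E * 2 ^ q * 3 ^ q * K * 2 ^ q with hC
  have hC0 : 0 ≤ C := by positivity
  refine ⟨fun k => π ^ (-(d : ℝ) / 2) * (r ^ d)⁻¹ * d.factorial * E ^ d * (2 * 2 ^ d) *
      (C ^ k / Gamma (k * (1 - α) + (d : ℝ) / 2)),
    (summable_pow_div_Gamma hC0 (by linarith) (by linarith)).mul_left _, ?_⟩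
  intro k c hc ρ u hρ
  have hρ0 : 0 < ρ := hr.trans_le hρ
  have hG : 0 < Gamma (k * (1 - α) + (d : ℝ) / 2) :=
    Gamma_pos_of_pos (by have : 0 ≤ (k : ℝ) * (1 - α) := mul_nonneg (by positivity) (by linarith)
                         linarith)
  have hrad : |radCoeff d α k ρ| * k.factorial
      ≤ (2 ^ α) ^ k * π ^ (-(d : ℝ) / 2) * (((r ^ α)⁻¹) ^ k * (r ^ d)⁻¹) := by
    have h2 : r ^ ((k : ℝ) * α + d) = (r ^ α) ^ k * r ^ d := by
      rw [rpow_add hr, rpow_natCast, mul_comm (k : ℝ) α, rpow_mul hr.le, rpow_natCast]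
    have h3 : (ρ ^ ((k : ℝ) * α + d))⁻¹ ≤ (r ^ ((k : ℝ) * α + d))⁻¹ := by
      gcongr
    have h4 : |radCoeff d α k ρ| * k.factorial
        = (2 ^ α) ^ k * π ^ (-(d : ℝ) / 2) * (ρ ^ ((k : ℝ) * α + d))⁻¹ := by
      rw [radCoeff, abs_div, abs_mul, abs_pow, abs_neg, abs_of_pos (show (0 : ℝ) < 2 ^ α by positivity),
        abs_of_pos (show 0 < π ^ (-(d : ℝ) / 2) by positivity),
        abs_of_pos (show 0 < (k.factorial : ℝ) * ρ ^ ((k : ℝ) * α + d) by positivity)]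
      have : ρ ^ ((k : ℝ) * α + d) ≠ 0 := by positivity
      field_simp
    rw [h4, inv_pow, ← mul_inv, ← h2]
    gcongr
  have hS : ∀ j ≤ k * q, ‖SHk d α (specMeasure d P) j k u‖
      ≤ 2 * 2 ^ (k * q + d) * 3 ^ (k * q) * K ^ k := fun j hj => by
    rw [SHk, norm_mul, norm_pow, norm_neg, Complex.norm_I, one_pow, one_mul]
    refine (norm_projC_le hd j (B := K ^ k) (fun v => ?_) u).trans ?_
    · rw [norm_pow]
      exact pow_le_pow_left₀ (norm_nonneg _) (hK v) k
    · have h1 : (cdim d j : ℝ) ≤ 2 * 2 ^ (j + d) := by exact_mod_cast cdim_le d j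
      have h2 : (2 : ℝ) ^ (j + d) ≤ 2 ^ (k * q + d) := by gcongr; norm_num
      have h3 : (3 : ℝ) ^ j ≤ 3 ^ (k * q) := by gcongr; norm_num
      gcongr
      linarith
  have hterm : ∀ j ∈ Finset.range (k * q + 1),
      ‖((radCoeff d α k ρ * c j : ℝ) : ℂ) * SHk d α (specMeasure d P) j k u‖
        ≤ (2 ^ α) ^ k * π ^ (-(d : ℝ) / 2) * (((r ^ α)⁻¹) ^ k * (r ^ d)⁻¹) *
          (d.factorial * E ^ (k + d) / Gamma (k * (1 - α) + (d : ℝ) / 2)) *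
          (2 * 2 ^ (k * q + d) * 3 ^ (k * q) * K ^ k) := fun j hj => by
    have hj' : j ≤ k * q := by rw [Finset.mem_range] at hj; omega
    rw [norm_mul, Complex.norm_real, norm_eq_abs, abs_mul,
      show |radCoeff d α k ρ| * |c j| = |radCoeff d α k ρ| * k.factorial * (|c j| / k.factorial) by
        have := k.factorial_ne_zero
        field_simp]
    exact mul_le_mul (mul_le_mul hrad (hc j hj') (by positivity) (by positivity)) (hS j hj')
      (norm_nonneg _) (by positivity)
  refine (Finset.sum_le_card_nsmul _ _ _ hterm).trans ?_
  rw [Finset.card_range, nsmul_eq_mul]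
  have hcard : ((k * q + 1 : ℕ) : ℝ) ≤ 2 ^ (k * q) := by
    exact_mod_cast Nat.lt_two_pow_self (n := k * q)
  refine (mul_le_mul_of_nonneg_right hcard (by positivity)).trans (le_of_eq ?_)
  rw [hC]
  simp only [mul_pow, pow_add, pow_mul', inv_pow]
  ring

lemma regInt_eq_sum (hd : 2 ≤ d) (hα0 : 0 < α) (hα1 : α < 1)
    (hpoly : IsPolyRestrictionDeg d q P) (hP0 : ∀ u, 0 ≤ P u) {ε : ℝ} (hε : 0 < ε)
    (x : Ed d) (hx : x ≠ 0) (k : ℕ) :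
    ((((2 * π) ^ d)⁻¹ : ℝ) : ℂ) * ((-1) ^ k / (k.factorial : ℂ) * regInt d α P k ε x)
      = ∑ j ∈ Finset.range (k * q + 1),
        ((radCoeff d α k ‖x‖ * regCoeff d α j k (‖x‖ ^ 2 / (4 * ε)) : ℝ) : ℂ) *
          SHk d α (specMeasure d P) j k (unitize x hx) := by
  have hρ : 0 < ‖x‖ := norm_pos_iff.2 hx
  obtain ⟨Y, hY, hV, hproj⟩ := exists_Vfun_pow_decomp hd hα0 hpoly hpoly.continuous hP0 k
  rw [regInt_eq (by omega) hα0 hα1 hpoly.continuous hP0 hε x hx k hY hV, Finset.mul_sum,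
    Finset.mul_sum]
  refine Finset.sum_congr rfl fun j hj => ?_
  rw [SHk, hproj j (by rw [Finset.mem_range] at hj; omega), ← regCoeff]
  have hrad : ((2 * π) ^ d)⁻¹ * ((-1) ^ k / (k.factorial : ℝ)) *
      (π ^ ((d : ℝ) / 2) * (2 / ‖x‖) ^ (k * α + d)) = radCoeff d α k ‖x‖ := by
    have h1 : π ^ d = π ^ ((d : ℝ) / 2) * π ^ ((d : ℝ) / 2) := by
      rw [← rpow_add pi_pos, add_halves, rpow_natCast]
    have h2 : (2 : ℝ) ^ ((k : ℝ) * α + d) = (2 ^ α) ^ k * 2 ^ d := by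
      rw [rpow_add two_pos, rpow_natCast, mul_comm (k : ℝ) α, rpow_mul two_pos.le, rpow_natCast]
    have h3 : 0 < π ^ ((d : ℝ) / 2) := by positivity
    have h4 : 0 < ‖x‖ ^ ((k : ℝ) * α + d) := by positivity
    rw [radCoeff, div_rpow two_pos.le hρ.le, h2, mul_pow, h1, neg_div, rpow_neg pi_pos.le,
      neg_pow (2 ^ α)]
    field_simp
  rw [← hrad]
  push_cast
  ring

lemma hasSum_reg (hd : 2 ≤ d) (hα0 : 0 < α) (hα1 : α < 1)
    (hpoly : IsPolyRestrictionDeg d q P) (hP0 : ∀ u, 0 ≤ P u) {ε : ℝ} (hε : 0 < ε)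
    (x : Ed d) (hx : x ≠ 0) :
    HasSum (fun k : ℕ => ∑ j ∈ Finset.range (k * q + 1),
        ((radCoeff d α k ‖x‖ * regCoeff d α j k (‖x‖ ^ 2 / (4 * ε)) : ℝ) : ℂ) *
          SHk d α (specMeasure d P) j k (unitize x hx))
      (((((2 * π) ^ d)⁻¹ : ℝ) : ℂ) * ∫ z : Ed d, Complex.exp (-(Complex.I * (⟪x, z⟫ : ℂ))) *
        ((rexp (-ε * ‖z‖ ^ 2) : ℝ) : ℂ) * Complex.exp (-charExp d α (specMeasure d P) z)) := by
  simp only [← regInt_eq_sum hd hα0 hα1 hpoly hP0 hε x hx]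
  exact (hasSum_regInt hα0 hα1 hpoly.continuous hP0 hε x).mul_left _

lemma tendsto_integral_regularized {f : Ed d → ℂ} (hf : Integrable f) (x : Ed d) :
    Tendsto (fun ε : ℝ => ∫ z : Ed d, Complex.exp (-(Complex.I * (⟪x, z⟫ : ℂ))) *
        ((rexp (-ε * ‖z‖ ^ 2) : ℝ) : ℂ) * f z) (𝓝[>] 0)
      (𝓝 (∫ z : Ed d, Complex.exp (-(Complex.I * (⟪x, z⟫ : ℂ))) * f z)) := by
  have hc : Continuous fun z : Ed d => Complex.exp (-(Complex.I * ((⟪x, z⟫ : ℝ) : ℂ))) := by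
    fun_prop
  refine tendsto_integral_filter_of_dominated_convergence (fun z => ‖f z‖) ?_ ?_ hf.norm ?_
  · refine Eventually.of_forall fun ε => ?_
    have : Continuous fun z : Ed d => Complex.exp (-(Complex.I * ((⟪x, z⟫ : ℝ) : ℂ))) *
        ((rexp (-ε * ‖z‖ ^ 2) : ℝ) : ℂ) := hc.mul (by fun_prop)
    exact this.aestronglyMeasurable.mul hf.aestronglyMeasurable
  · filter_upwards [self_mem_nhdsWithin] with ε hε
    refine Eventually.of_forall fun z => ?_
    rw [norm_mul, norm_mul, norm_exp_neg_I_mul, one_mul, Complex.norm_real, norm_eq_abs,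
      abs_of_pos (exp_pos _)]
    refine mul_le_of_le_one_left (norm_nonneg _) (exp_le_one_iff.2 ?_)
    have : 0 ≤ ε * ‖z‖ ^ 2 := mul_nonneg (le_of_lt hε) (by positivity)
    linarith
  · refine Eventually.of_forall fun z => ?_
    have h : Continuous fun ε : ℝ => Complex.exp (-(Complex.I * ((⟪x, z⟫ : ℝ) : ℂ))) *
        ((rexp (-ε * ‖z‖ ^ 2) : ℝ) : ℂ) * f z := by fun_prop
    have := (h.tendsto 0).mono_left (nhdsWithin_le_nhds (s := Set.Ioi 0))
    simpa using this

lemma phiTerm_eq (j k : ℕ) (ρ : ℝ) (u : Sph d) :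
    phiTerm d α (specMeasure d P) j k ρ u = ((radCoeff d α k ρ *
      (Gamma (((j : ℝ) + k * α + d) / 2) / Gamma (((j : ℝ) - k * α) / 2)) : ℝ) : ℂ) *
        SHk d α (specMeasure d P) j k u := by
  rw [phiTerm, radCoeff]

lemma exists_summable_bound_phiTerm (hd : 2 ≤ d) (hα0 : 0 < α) (hα1 : α < 1) (hP : Continuous P)
    (hP0 : ∀ u, 0 ≤ P u) (q : ℕ) {r : ℝ} (hr : 0 < r) :
    ∃ M : ℕ → ℝ, Summable M ∧ ∀ (k : ℕ) (ρ : ℝ) (u : Sph d), r ≤ ρ →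
      ∑ j ∈ Finset.range (k * q + 1), ‖phiTerm d α (specMeasure d P) j k ρ u‖ ≤ M k := by
  obtain ⟨M, hM, hb⟩ := exists_summable_bound hd hα0 hα1 hP hP0 q hr
  refine ⟨M, hM, fun k ρ u hρ => ?_⟩
  simp only [phiTerm_eq]
  exact hb k _ (fun j hj => abs_Gamma_quotient_le hd hα0 hα1 hj) ρ u hρ

lemma density_eq_tsum (hd : 2 ≤ d) (hα0 : 0 < α) (hα1 : α < 1)
    (hpoly : IsPolyRestrictionDeg d q P) (hP0 : ∀ u, 0 ≤ P u) (hPne : P ≠ 0)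
    (x : Ed d) (hx : x ≠ 0) :
    ((((2 * π) ^ d)⁻¹ : ℝ) : ℂ) * ∫ z : Ed d, Complex.exp (-(Complex.I * (⟪x, z⟫ : ℂ))) *
        Complex.exp (-charExp d α (specMeasure d P) z)
      = ∑' k : ℕ, ∑ j ∈ Finset.range (k * q + 1),
        phiTerm d α (specMeasure d P) j k ‖x‖ (unitize x hx) := by
  have hP := hpoly.continuous
  have hρ : 0 < ‖x‖ := norm_pos_iff.2 hx
  obtain ⟨M, hM, hb⟩ := exists_summable_bound hd hα0 hα1 hP hP0 q hρ
  have hy : Tendsto (fun ε : ℝ => ‖x‖ ^ 2 / (4 * ε)) (𝓝[>] 0) atTop := by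
    have := (tendsto_inv_nhdsGT_zero (𝕜 := ℝ)).const_mul_atTop
      (show (0 : ℝ) < ‖x‖ ^ 2 / 4 by positivity)
    refine this.congr fun ε => ?_
    rw [← div_eq_mul_inv, div_div]
  have h1 := (tendsto_integral_regularized
    (integrable_exp_neg_charExp (by omega) hα0 hP hP0 hPne) x).const_mul
      ((((2 * π) ^ d)⁻¹ : ℝ) : ℂ)
  have h2 : Tendsto (fun ε : ℝ => ∑' k : ℕ, ∑ j ∈ Finset.range (k * q + 1),
        ((radCoeff d α k ‖x‖ * regCoeff d α j k (‖x‖ ^ 2 / (4 * ε)) : ℝ) : ℂ) *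
          SHk d α (specMeasure d P) j k (unitize x hx)) (𝓝[>] 0)
      (𝓝 (∑' k : ℕ, ∑ j ∈ Finset.range (k * q + 1),
        phiTerm d α (specMeasure d P) j k ‖x‖ (unitize x hx))) := by
    refine tendsto_tsum_of_dominated_convergence hM (fun k => ?_) ?_
    · refine tendsto_finsetSum _ fun j _ => ?_
      rw [phiTerm_eq]
      exact (Complex.continuous_ofReal.continuousAt.tendsto.comp
        (((tendsto_regCoeff (by omega) hα0 j k).comp hy).const_mul _)).mul_const _
    · filter_upwards [self_mem_nhdsWithin] with ε hε k
      have hε : 0 < ε := hε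
      exact (norm_sum_le _ _).trans (hb k _
        (fun j hj => kummer_coeff_bound hd hα0 hα1 hj (by positivity)) _ _ le_rfl)
  refine tendsto_nhds_unique h1 (h2.congr' ?_)
  filter_upwards [self_mem_nhdsWithin] with ε hε
  exact (hasSum_reg hd hα0 hα1 hpoly hP0 hε x hx).tsum_eq

end

/-- Theorem (density, `α ∈ (0,1)`, polynomial spectral density): `exp(-Φ_μ) ∈ L¹`, and
`g(x) = Σ_{k≥1} ((-2^α)^k π^{-d/2}/(k!|x|^{kα+d})) Σ_{j=0}^{kq} (Γ((j+kα+d)/2)/Γ((j-kα)/2))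
S_{j,k}(u_x)` for `x ≠ 0`, the double series converging absolutely, uniformly on
`{|x| ≥ r}` for every `r > 0`. -/
theorem stmt9 (d : ℕ) (hd : 2 ≤ d) (α : ℝ) (hα0 : 0 < α) (hα1 : α < 1) (q : ℕ)
    (P : Sph d → ℝ) (hpoly : IsPolyRestrictionDeg d q P) (hP0 : ∀ u, 0 ≤ P u) (hPne : P ≠ 0)
    (μ : Measure (Ed d)) [IsProbabilityMeasure μ]
    (hμ : IsStableChar d α (specMeasure d P) μ)
    (g : Ed d → ℝ) (hg : IsDensityOf d α (specMeasure d P) g) :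
    Integrable (fun z : Ed d => Complex.exp (- charExp d α (specMeasure d P) z)) ∧
    (∀ (x : Ed d) (hx : x ≠ 0),
      (g x : ℂ) = ∑' k : ℕ, ∑ j ∈ Finset.range ((k + 1) * q + 1),
        phiTerm d α (specMeasure d P) j (k + 1) ‖x‖ (unitize x hx)) ∧
    (∀ r : ℝ, 0 < r → ∃ M : ℕ → ℝ, Summable M ∧
      ∀ (k : ℕ) (x : Ed d) (hx : x ≠ 0), r ≤ ‖x‖ →
        ∑ j ∈ Finset.range ((k + 1) * q + 1),
          ‖phiTerm d α (specMeasure d P) j (k + 1) ‖x‖ (unitize x hx)‖ ≤ M k) := by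
  have hP := hpoly.continuous
  refine ⟨integrable_exp_neg_charExp (by omega) hα0 hP hP0 hPne, fun x hx => ?_, fun r hr => ?_⟩
  · obtain ⟨M, hM, hb⟩ := exists_summable_bound_phiTerm hd hα0 hα1 hP hP0 q (norm_pos_iff.2 hx)
    have hs : Summable fun k : ℕ => ∑ j ∈ Finset.range (k * q + 1),
        phiTerm d α (specMeasure d P) j k ‖x‖ (unitize x hx) :=
      hM.of_norm_bounded fun k => (norm_sum_le _ _).trans (hb k _ _ le_rfl)
    rw [hg x, density_eq_tsum hd hα0 hα1 hpoly hP0 hPne x hx, hs.tsum_eq_zero_add]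
    simp [phiTerm, Gamma_zero]
  · obtain ⟨M, hM, hb⟩ := exists_summable_bound_phiTerm hd hα0 hα1 hP hP0 q hr
    exact ⟨fun k => M (k + 1), (summable_nat_add_iff 1).2 hM,
      fun k x hx hrx => hb (k + 1) _ _ hrx⟩

end StablePaper
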